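/- arXiv:2605.15884 — 4 statements merged into one kernel-verified Lean document; each statement's English description precedes it below -/
import Mathlib

section
/- Let R be the unicyclic generator on n ≥ 3 states with rates k⁺ᵢ > 0, k⁻ᵢ ≥ 0 (hence R is irreducible). List the n eigenvalues of R, i.e. the roots of its characteristic polynomial counted with multiplicity, as λ₁, λ₂, …, λₙ with Re λ₁ ≥ Re λ₂ ≥ ⋯ ≥ Re λₙ (so λ₁ = 0). Then for every index k such that λ_k is nonreal and every left eigenvector u of R associated to λ_k, all components uᵢ are nonzero and the winding number satisfies ω(u) = ⌊k/2⌋. -/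
open Matrix Finset

/-- Wrapped frequency `|k|ₙ := min (k mod n) ((n - k) mod n)`. -/
def wrapIdx (n : ℕ) (k : ℤ) : ℤ :=
  min (k % (n : ℤ)) (((n : ℤ) - k) % (n : ℤ))

/-- Winding number `ω(u)` of a vector `u` around the unicycle:
`|(1/2π) ∑ᵢ Arg (u_{i+1}/uᵢ)|ₙ` (the sum divided by `2π` is an integer
whenever `u` is an eigenvector with all components nonzero). -/
noncomputable def windingNum (n : ℕ) [NeZero n] (u : ZMod n → ℂ) : ℤ :=
  wrapIdx n (round ((∑ i : ZMod n, Complex.arg (u (i + 1) / u i)) / (2 * Real.pi)))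

/-- The unicyclic generator on `n` states with forward rates `kp` and backward
rates `km`, viewed as a complex matrix: `R j i = kpᵢ` if `j = i+1`, `kmᵢ` if
`j = i-1`, `-(kpᵢ+kmᵢ)` if `j = i`, and `0` otherwise. -/
noncomputable def uniGenC (n : ℕ) [NeZero n] (kp km : ZMod n → ℝ) :
    Matrix (ZMod n) (ZMod n) ℂ :=
  Matrix.of fun j i =>
    if j = i + 1 then (kp i : ℂ)
    else if j = i - 1 then (km i : ℂ)
    else if j = i then -((kp i : ℂ) + (km i : ℂ))
    else 0

/-- `T = tanh (F / 2n)` where `F = ∑ᵢ ln (kpᵢ/kmᵢ)` is the cycle affinity;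
`T = 1` when the affinity is infinite (some `kmᵢ = 0`). -/
noncomputable def uniT (n : ℕ) [NeZero n] (kp km : ZMod n → ℝ) : ℝ :=
  open Classical in
  if ∀ i, km i ≠ 0 then
    Real.tanh ((∑ i : ZMod n, Real.log (kp i / km i)) / (2 * n))
  else 1

/-- The periodic tridiagonal matrix with diagonal `a`, forward entries `-b` and backward
entries `-c`. -/
def periodicJacobi (n : ℕ) (a b c : ZMod n → ℂ) : Matrix (ZMod n) (ZMod n) ℂ :=
  Matrix.of fun i j =>
    if j = i + 1 then -b i
    else if j = i - 1 then -c i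
    else if j = i then a i
    else 0

namespace periodicJacobi

variable {n : ℕ}

lemma add_one_ne_self (hn : 3 ≤ n) (i : ZMod n) : i + 1 ≠ i := by
  have : Fact (1 < n) := ⟨by omega⟩
  simp

lemma sub_one_ne_self (hn : 3 ≤ n) (i : ZMod n) : i - 1 ≠ i := by
  have : Fact (1 < n) := ⟨by omega⟩
  simp

lemma add_one_ne_sub_one (hn : 3 ≤ n) (i : ZMod n) : i + 1 ≠ i - 1 := by
  intro h
  have h2 : ((2 : ℕ) : ZMod n) = 0 := by
    push_cast
    linear_combination h
  rw [ZMod.natCast_eq_zero_iff] at h2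
  exact absurd (Nat.le_of_dvd (by norm_num) h2) (by omega)

lemma forall_of_add_one [NeZero n] {p : ZMod n → Prop} (i₀ : ZMod n) (h₀ : p i₀)
    (h : ∀ i, p i → p (i + 1)) (i : ZMod n) : p i := by
  have key : ∀ m : ℕ, p (i₀ + m) := by
    intro m
    induction m with
    | zero => simpa using h₀
    | succ m ih =>
      have := h _ ih
      rwa [add_assoc, ← Nat.cast_succ] at this
  have := key (i - i₀).val
  simpa using this

/-- A permutation moving every point by at most one step along the cycle is a rotation or
a product of disjoint adjacent transpositions. -/
lemma perm_cases [NeZero n] (hn : 3 ≤ n) (σ : Equiv.Perm (ZMod n))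
    (hσ : ∀ i, σ i = i + 1 ∨ σ i = i - 1 ∨ σ i = i) :
    σ = Equiv.addRight 1 ∨ σ = Equiv.subRight 1 ∨ ∀ i, σ i = i + 1 ↔ σ (i + 1) = i := by
  by_cases h1 : ∀ i, σ i = i + 1 → σ (i + 1) = i
  · by_cases h2 : ∀ i, σ (i + 1) = i → σ i = i + 1
    · exact Or.inr (Or.inr fun i => ⟨h1 i, h2 i⟩)
    · right; left
      push Not at h2
      obtain ⟨i, hi, hi'⟩ := h2
      have step : ∀ j, (σ (j + 1) = j ∧ σ j = j - 1) →
          (σ (j - 1 + 1) = j - 1 ∧ σ (j - 1) = j - 1 - 1) := by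
        rintro j ⟨ha, hb⟩
        refine ⟨by rw [sub_add_cancel]; exact hb, ?_⟩
        rcases hσ (j - 1) with h | h | h
        · rw [sub_add_cancel] at h
          have := σ.injective (h.trans ha.symm)
          exact absurd this.symm (add_one_ne_sub_one hn j)
        · exact h
        · have := σ.injective (h.trans hb.symm)
          exact absurd this (sub_one_ne_self hn j)
      have base : σ (i + 1) = i ∧ σ i = i - 1 := by
        refine ⟨hi, ?_⟩
        rcases hσ i with h | h | h
        · exact absurd h hi'
        · exact h
        · exact absurd (σ.injective (hi.trans h.symm)) (add_one_ne_self hn i)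
      have all := forall_of_add_one (p := fun j => σ (-j + 1) = -j ∧ σ (-j) = -j - 1) (-i)
        (by simpa using base) (fun j hj => by
          have := step _ hj
          have e : -(j + 1) = -j - 1 := by ring
          rwa [e])
      refine Equiv.ext fun j => ?_
      simpa using (all (-j)).2
  · left
    push Not at h1
    obtain ⟨i, hi, hi'⟩ := h1
    have step : ∀ j, (σ j = j + 1 ∧ σ (j + 1) = j + 1 + 1) →
        (σ (j + 1) = j + 1 + 1 ∧ σ (j + 1 + 1) = j + 1 + 1 + 1) := by
      rintro j ⟨ha, hb⟩
      refine ⟨hb, ?_⟩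
      rcases hσ (j + 1 + 1) with h | h | h
      · exact h
      · have := σ.injective (h.trans ((add_sub_cancel_right (j + 1) 1).trans ha.symm))
        exact absurd (show j + 1 + 1 = j + 1 - 1 by simpa using this)
          (add_one_ne_sub_one hn (j + 1))
      · have := σ.injective (h.trans hb.symm)
        exact absurd this (add_one_ne_self hn (j + 1))
    have base : σ i = i + 1 ∧ σ (i + 1) = i + 1 + 1 := by
      refine ⟨hi, ?_⟩
      rcases hσ (i + 1) with h | h | h
      · exact h
      · exact absurd (h.trans (add_sub_cancel_right _ _)) hi'
      · exact absurd (σ.injective (h.trans hi.symm)) (add_one_ne_self hn i)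
    have all := forall_of_add_one
      (p := fun j => σ j = j + 1 ∧ σ (j + 1) = j + 1 + 1) i base step
    exact Equiv.ext fun j => by simpa using (all j).1

lemma sign_addRight_one [NeZero n] :
    Equiv.Perm.sign (Equiv.addRight (1 : ZMod n)) = (-1) ^ (n - 1) := by
  obtain _ | n := n
  · exact absurd rfl (NeZero.ne 0)
  · have : (Equiv.addRight (1 : ZMod (n + 1)) : Equiv.Perm (Fin (n + 1))) = finRotate (n + 1) :=
      Equiv.ext fun i => (finRotate_apply i).symm
    exact (congrArg Equiv.Perm.sign this).trans (sign_finRotate (n + 1))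

lemma sign_subRight_one [NeZero n] :
    Equiv.Perm.sign (Equiv.subRight (1 : ZMod n)) = (-1) ^ (n - 1) := by
  have : Equiv.subRight (1 : ZMod n) = (Equiv.addRight (1 : ZMod n))⁻¹ := by
    refine Equiv.ext fun i => ?_
    rw [Equiv.Perm.eq_inv_iff_eq]
    simp
  rw [this, Equiv.Perm.sign_inv, sign_addRight_one]

lemma prod_apply_of_involutive [NeZero n] (hn : 3 ≤ n) (a b c : ZMod n → ℂ)
    (σ : Equiv.Perm (ZMod n)) (hσ : ∀ i, σ i = i + 1 ∨ σ i = i - 1 ∨ σ i = i)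
    (h : ∀ i, σ i = i + 1 ↔ σ (i + 1) = i) :
    ∏ i, periodicJacobi n a b c i (σ i) =
      ∏ i, (if σ i = i then a i else 1) * (if σ i = i + 1 then b i * c (i + 1) else 1) := by
  have h1 : ∀ i, periodicJacobi n a b c i (σ i) =
      ((if σ i = i then a i else 1) * (if σ i = i + 1 then -b i else 1)) *
        (if σ i = i - 1 then -c i else 1) := by
    intro i
    have e1 := add_one_ne_self hn i
    have e2 := sub_one_ne_self hn i
    have e3 := add_one_ne_sub_one hn i
    rcases hσ i with h | h | h <;>
      simp [periodicJacobi, h, e1, e2, e3, e1.symm, e2.symm, e3.symm]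
  rw [Finset.prod_congr rfl fun i _ => h1 i, Finset.prod_mul_distrib,
    ← Equiv.prod_comp (Equiv.addRight (1 : ZMod n)) fun i => if σ i = i - 1 then -c i else 1,
    ← Finset.prod_mul_distrib]
  refine Finset.prod_congr rfl fun i _ => ?_
  simp only [Equiv.coe_addRight, add_sub_cancel_right, ← h i]
  split_ifs <;> ring

lemma prod_apply_eq_zero {a b c : ZMod n → ℂ} [NeZero n] (σ : Equiv.Perm (ZMod n))
    (hσ : ¬ ∀ i, σ i = i + 1 ∨ σ i = i - 1 ∨ σ i = i) :
    ∏ i, periodicJacobi n a b c i (σ i) = 0 := by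
  push Not at hσ
  obtain ⟨i, h1, h2, h3⟩ := hσ
  exact Finset.prod_eq_zero (Finset.mem_univ i) (by simp [periodicJacobi, h1, h2, h3])

lemma det_eq_sum [NeZero n] (a b c : ZMod n → ℂ) :
    (periodicJacobi n a b c).det = ∑ σ : Equiv.Perm (ZMod n),
      ((Equiv.Perm.sign σ : ℤ) : ℂ) * ∏ i, periodicJacobi n a b c i (σ i) := by
  rw [← det_transpose, det_apply']
  rfl

/-- Up to the contribution of the two rotations, the determinant depends on the off-diagonal
entries only through the products `b i * c (i + 1)`. -/
theorem det_add_prod_eq [NeZero n] (hn : 3 ≤ n) (a b c b' c' : ZMod n → ℂ)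
    (h : ∀ i, b i * c (i + 1) = b' i * c' (i + 1)) :
    (periodicJacobi n a b c).det + ∏ i, b i + ∏ i, c i =
      (periodicJacobi n a b' c').det + ∏ i, b' i + ∏ i, c' i := by
  have hne : Equiv.addRight (1 : ZMod n) ≠ Equiv.subRight 1 := fun e =>
    add_one_ne_sub_one hn 0 (by simpa using congrArg (fun f : Equiv.Perm (ZMod n) => f 0) e)
  have hsgn : ((-1 : ℂ)) ^ (n - 1) * (-1) ^ n = -1 := by
    rw [← pow_add, show n - 1 + n = 2 * (n - 1) + 1 by omega, pow_succ, pow_mul]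
    simp
  have hadd : ∀ a b c : ZMod n → ℂ,
      ∏ i, periodicJacobi n a b c i (Equiv.addRight (1 : ZMod n) i) = (-1) ^ n * ∏ i, b i := by
    intro a b c
    simp [periodicJacobi, Finset.prod_neg, ZMod.card]
  have hsub : ∀ a b c : ZMod n → ℂ,
      ∏ i, periodicJacobi n a b c i (Equiv.subRight (1 : ZMod n) i) = (-1) ^ n * ∏ i, c i := by
    intro a b c
    simp [periodicJacobi, Finset.prod_neg, ZMod.card, (add_one_ne_sub_one hn _).symm]
  have key : ∀ a b c : ZMod n → ℂ, (periodicJacobi n a b c).det + ∏ i, b i + ∏ i, c i =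
      ∑ σ ∈ (Finset.univ.erase (Equiv.addRight (1 : ZMod n))).erase (Equiv.subRight 1),
        ((Equiv.Perm.sign σ : ℤ) : ℂ) * ∏ i, periodicJacobi n a b c i (σ i) := by
    intro a b c
    rw [det_eq_sum, ← Finset.add_sum_erase _ _ (Finset.mem_univ (Equiv.addRight (1 : ZMod n))),
      ← Finset.add_sum_erase (Finset.univ.erase _) _
        (Finset.mem_erase.2 ⟨hne.symm, Finset.mem_univ (Equiv.subRight (1 : ZMod n))⟩),
      hadd, hsub, sign_addRight_one, sign_subRight_one]
    push_cast
    linear_combination (∏ i, b i + ∏ i, c i) * hsgn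
  rw [key, key]
  refine Finset.sum_congr rfl fun σ hσ => ?_
  congr 1
  by_cases hs : ∀ i, σ i = i + 1 ∨ σ i = i - 1 ∨ σ i = i
  · simp only [Finset.mem_erase, Finset.mem_univ, and_true] at hσ
    have hinv := ((perm_cases hn σ hs).resolve_left hσ.2).resolve_left hσ.1
    rw [prod_apply_of_involutive hn a b c σ hs hinv,
      prod_apply_of_involutive hn a b' c' σ hs hinv]
    simp only [h]
  · rw [prod_apply_eq_zero σ hs, prod_apply_eq_zero σ hs]

lemma mulVec_apply [NeZero n] (hn : 3 ≤ n) (a b c u : ZMod n → ℂ) (i : ZMod n) :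
    (periodicJacobi n a b c *ᵥ u) i = a i * u i - b i * u (i + 1) - c i * u (i - 1) := by
  have e1 := add_one_ne_self hn i
  have e2 := sub_one_ne_self hn i
  have e3 := add_one_ne_sub_one hn i
  have : ∀ j, periodicJacobi n a b c i j * u j =
      (if j = i + 1 then -b i * u (i + 1) else 0) + (if j = i - 1 then -c i * u (i - 1) else 0) +
        (if j = i then a i * u i else 0) := by
    intro j
    unfold periodicJacobi
    by_cases h1 : j = i + 1
    · subst h1; simp [e1, e3]
    · by_cases h2 : j = i - 1
      · subst h2; simp [e2, e3.symm]
      · by_cases h3 : j = i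
        · subst h3; simp [e1.symm, e2.symm]
        · simp [h1, h2, h3]
  simp only [mulVec, dotProduct, this, Finset.sum_add_distrib, Finset.sum_ite_eq',
    Finset.mem_univ, if_true]
  ring

end periodicJacobi

open scoped ComplexConjugate

section HalfPlane

lemma neg_I_mul_mem_slitPlane {w : ℂ} (hw : 0 ≤ w.im) (h0 : w ≠ 0) :
    -Complex.I * w ∈ Complex.slitPlane := by
  rw [Complex.mem_slitPlane_iff]
  simp only [neg_mul, Complex.neg_re, Complex.mul_re, Complex.I_re, Complex.I_im, Complex.neg_im,
    Complex.mul_im]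
  rcases hw.lt_or_eq with h | h
  · left; linarith
  · right
    intro h'
    exact h0 (Complex.ext (by simpa using h') (by simpa using h.symm))

lemma arg_neg_I_mul {w : ℂ} (hw : 0 ≤ w.im) (h0 : w ≠ 0) :
    Complex.arg (-Complex.I * w) = Complex.arg w - Real.pi / 2 := by
  have := Real.pi_pos
  rw [(Complex.arg_mul_eq_add_arg_iff (by simp) h0).2, Complex.arg_neg_I]
  · ring
  · rw [Complex.arg_neg_I]
    have h1 := Complex.arg_nonneg_iff.2 hw
    have h2 := Complex.arg_le_pi w
    constructor <;> linarith

/-- The logarithm has divided differences in the lower half plane on the closed upper half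
plane. -/
lemma im_conj_mul_log_sub_neg {A B : ℂ} (hA : 0 ≤ A.im) (hB : 0 ≤ B.im) (hA0 : A ≠ 0)
    (hB0 : B ≠ 0) (hne : A ≠ B) (hpos : 0 < A.im ∨ 0 < B.im) :
    (conj (A - B) * (Complex.log (-Complex.I * A) - Complex.log (-Complex.I * B))).im < 0 := by
  set γ : ℝ → ℂ := fun s => B + s * (A - B) with hγ
  have him : ∀ s, (γ s).im = (1 - s) * B.im + s * A.im := by
    intro s
    simp [hγ]
    ring
  have hd : 0 < Complex.normSq (A - B) := Complex.normSq_pos.2 (sub_ne_zero.2 hne)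
  have hslit : ∀ s ∈ Set.Icc (0 : ℝ) 1, -Complex.I * γ s ∈ Complex.slitPlane := by
    rintro s ⟨hs0, hs1⟩
    have hnn : 0 ≤ (γ s).im := by
      rw [him]
      exact add_nonneg (mul_nonneg (by linarith) hB) (mul_nonneg hs0 hA)
    refine neg_I_mul_mem_slitPlane hnn fun h0 => ?_
    rcases hs0.lt_or_eq with h | h
    · rcases hs1.lt_or_eq with h' | h'
      · have hz : (γ s).im = 0 := by rw [h0]; rfl
        rw [him] at hz
        rcases hpos with hp | hp
        · nlinarith [mul_pos h hp, mul_nonneg (sub_nonneg.2 hs1) hB]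
        · nlinarith [mul_pos (sub_pos.2 h') hp, mul_nonneg hs0 hA]
      · exact hA0 (by simpa [hγ, h'] using h0)
    · exact hB0 (by simpa [hγ, ← h] using h0)
  have hderiv : ∀ s ∈ Set.Icc (0 : ℝ) 1,
      HasDerivAt (fun s => (conj (A - B) * Complex.log (-Complex.I * γ s)).im)
        (-(Complex.normSq (A - B) * ((γ s).im / Complex.normSq (γ s)))) s := by
    intro s hs
    have h1 : HasDerivAt γ (A - B) s := by
      simpa [hγ] using ((Complex.ofRealCLM.hasDerivAt (x := s)).mul_const (A - B)).const_add B
    have h2 := ((h1.const_mul (-Complex.I)).clog_real (hslit s hs)).const_mul (conj (A - B))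
    have h3 := Complex.imCLM.hasFDerivAt.comp_hasDerivAt s h2
    have e : conj (A - B) * (-Complex.I * (A - B) / (-Complex.I * γ s)) =
        (Complex.normSq (A - B) : ℂ) * (γ s)⁻¹ := by
      rw [mul_div_mul_left _ _ (by simp : -Complex.I ≠ 0), Complex.normSq_eq_conj_mul_self]
      ring
    refine h3.congr_deriv ?_
    rw [e, Complex.imCLM_apply, Complex.im_ofReal_mul, Complex.inv_im]
    ring
  have hanti := strictAntiOn_of_deriv_neg (convex_Icc (0 : ℝ) 1)
    (f := fun s => (conj (A - B) * Complex.log (-Complex.I * γ s)).im)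
    (fun s hs => (hderiv s hs).continuousAt.continuousWithinAt) (by
      intro s hs
      rw [interior_Icc] at hs
      rw [(hderiv s ⟨hs.1.le, hs.2.le⟩).deriv]
      have hp : 0 < (γ s).im := by
        rw [him]
        have := sub_pos.2 hs.2
        rcases hpos with hp | hp
        · exact add_pos_of_nonneg_of_pos (mul_nonneg this.le hB) (mul_pos hs.1 hp)
        · exact add_pos_of_pos_of_nonneg (mul_pos this hp) (mul_nonneg hs.1.le hA)
      have hq : 0 < Complex.normSq (γ s) := Complex.normSq_pos.2 fun h => by
        rw [h] at hp
        exact lt_irrefl _ hp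
      exact neg_neg_of_pos (mul_pos hd (div_pos hp hq)))
  have := hanti (Set.left_mem_Icc.2 zero_le_one) (Set.right_mem_Icc.2 zero_le_one) zero_lt_one
  simp only [hγ, Complex.ofReal_one, one_mul, Complex.ofReal_zero, zero_mul, add_zero,
    add_sub_cancel] at this
  rw [mul_sub, Complex.sub_im]
  linarith

end HalfPlane

/-- The sum of the absolute arguments of `z - r i`: the argument of `∏ i, (z - r i)`, lifted
continuously along the closed upper half plane and extended by conjugation. -/
noncomputable def angleSum {ι : Type*} [Fintype ι] (r : ι → ℝ) (z : ℂ) : ℝ :=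
  ∑ i, |Complex.arg (z - r i)|

section AngleSum

variable {ι : Type*} [Fintype ι] {r : ι → ℝ} {z w : ℂ} {c : ℝ}

lemma angleSum_of_im_nonneg (hz : 0 ≤ z.im) : angleSum r z = ∑ i, Complex.arg (z - r i) :=
  Finset.sum_congr rfl fun i _ => abs_of_nonneg (Complex.arg_nonneg_iff.2 (by simpa using hz))

lemma angleSum_conj : angleSum r (conj z) = angleSum r z := by
  refine Finset.sum_congr rfl fun i _ => ?_
  rw [show conj z - (r i : ℂ) = conj (z - r i) by simp, Complex.arg_conj]
  split_ifs with h
  · rw [h]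
  · rw [abs_neg]

lemma angleSum_nonneg : 0 ≤ angleSum r z := Finset.sum_nonneg fun _ _ => abs_nonneg _

lemma angleSum_le : angleSum r z ≤ Fintype.card ι * Real.pi := by
  have := Finset.sum_le_card_nsmul Finset.univ (fun i => |Complex.arg (z - r i)|) Real.pi
    fun i _ => Complex.abs_arg_le_pi _
  simpa [angleSum] using this

lemma angleSum_lt [Nonempty ι] (hz : z.im ≠ 0) : angleSum r z < Fintype.card ι * Real.pi := by
  have : angleSum r z < ∑ _i : ι, Real.pi :=
    Finset.sum_lt_sum_of_nonempty Finset.univ_nonempty fun i _ => by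
      refine lt_of_le_of_ne (Complex.abs_arg_le_pi _) fun h => ?_
      have h' : Complex.arg (z - r i) = Real.pi :=
        ((abs_eq Real.pi_pos.le).1 h).resolve_right (Complex.neg_pi_lt_arg _).ne'
      exact hz (by simpa using (Complex.arg_eq_pi_iff.1 h').2)
  simpa using this

lemma angleSum_pos [Nonempty ι] (hz : z.im ≠ 0) : 0 < angleSum r z :=
  Finset.sum_pos (fun i _ => abs_pos.2 fun h =>
    hz (by simpa using (Complex.arg_eq_zero_iff.1 h).2)) Finset.univ_nonempty

lemma sub_ne_zero_of_prod (hc : c ≠ 0) (hz : ∏ i, (z - r i) = c) (i : ι) : z - r i ≠ 0 :=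
  fun h => hc (by exact_mod_cast hz.symm.trans (Finset.prod_eq_zero (Finset.mem_univ i) h))

lemma prod_conj_sub (hz : ∏ i, (z - r i) = c) : ∏ i, (conj z - r i) = (c : ℂ) := by
  simpa using congrArg conj hz

lemma exists_angleSum_eq (hc : 0 < c) (hz : ∏ i, (z - r i) = c) :
    ∃ a : ℕ, angleSum r z = 2 * Real.pi * a := by
  wlog him : 0 ≤ z.im generalizing z
  · rw [← angleSum_conj]
    exact this (prod_conj_sub hz) (by simpa using (not_le.1 him).le)
  have hpi := Real.pi_pos
  have h1 : (c : ℂ) * Complex.exp (angleSum r z * Complex.I) = c := by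
    have habs : ∏ i, ‖z - r i‖ = c := by
      rw [← norm_prod, hz, Complex.norm_of_nonneg hc.le]
    rw [angleSum_of_im_nonneg him]
    conv_rhs => rw [← hz]
    rw [← habs]
    push_cast
    rw [Finset.sum_mul, Complex.exp_sum, ← Finset.prod_mul_distrib]
    exact Finset.prod_congr rfl fun i _ => Complex.norm_mul_exp_arg_mul_I _
  have h2 : Complex.exp (angleSum r z * Complex.I) = 1 :=
    mul_left_cancel₀ (Complex.ofReal_ne_zero.2 hc.ne') (h1.trans (mul_one _).symm)
  obtain ⟨m, hm⟩ := Complex.exp_eq_one_iff.1 h2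
  have hval : angleSum r z = 2 * Real.pi * m := by
    have h3 := congrArg Complex.im hm
    simp at h3
    linarith
  have hm0 : 0 ≤ m := by
    have h4 : 0 ≤ 2 * Real.pi * (m : ℝ) := hval ▸ angleSum_nonneg
    exact_mod_cast nonneg_of_mul_nonneg_right h4 (by positivity)
  lift m to ℕ using hm0
  exact ⟨m, by simpa using hval⟩

/-- Among the solutions of `∏ i, (z - r i) = c`, the angle sum decreases as the real part
increases. -/
lemma re_sub_mul_angleSum_sub_neg [Nonempty ι] (hc : c ≠ 0) (hz : ∏ i, (z - r i) = c)
    (hw : ∏ i, (w - r i) = c) (hz0 : z.im ≠ 0) (hne : w ≠ z) (hne' : w ≠ conj z) :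
    (z.re - w.re) * (angleSum r z - angleSum r w) < 0 := by
  wlog hzi : 0 ≤ z.im generalizing z
  · have := this (prod_conj_sub hz) (by simpa using hz0) hne' (by simpa using hne)
      (by simpa using (not_le.1 hzi).le)
    simpa [angleSum_conj] using this
  wlog hwi : 0 ≤ w.im generalizing w
  · have := this (prod_conj_sub hw)
      (fun h => hne' (by rw [← h, Complex.conj_conj]))
      (fun h => hne ((starRingEnd ℂ).injective h)) (by simpa using (not_le.1 hwi).le)
    simpa [angleSum_conj] using this
  have hsum : (∑ i, conj (z - w) * (Complex.log (-Complex.I * (z - r i)) -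
      Complex.log (-Complex.I * (w - r i)))).im < 0 := by
    rw [Complex.im_sum]
    refine Finset.sum_neg (fun i _ => ?_) Finset.univ_nonempty
    have := im_conj_mul_log_sub_neg (A := z - r i) (B := w - r i) (by simpa using hzi)
      (by simpa using hwi) (sub_ne_zero_of_prod hc hz i) (sub_ne_zero_of_prod hc hw i)
      (by simpa using hne.symm) (Or.inl (by simpa using lt_of_le_of_ne hzi hz0.symm))
    simpa using this
  have hre : ∀ v : ℂ, ∏ i, (v - r i) = (c : ℂ) →
      (∑ i, Complex.log (-Complex.I * (v - r i))).re = Real.log |c| := by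
    intro v hv
    rw [Complex.re_sum]
    simp only [Complex.log_re, norm_mul, norm_neg, Complex.norm_I, one_mul]
    rw [← Real.log_prod fun i _ => norm_ne_zero_iff.2 (sub_ne_zero_of_prod hc hv i), ← norm_prod,
      hv, Complex.norm_real, Real.norm_eq_abs]
  have him : ∀ v : ℂ, 0 ≤ v.im → ∏ i, (v - r i) = (c : ℂ) →
      (∑ i, Complex.log (-Complex.I * (v - r i))).im =
        angleSum r v - Fintype.card ι * (Real.pi / 2) := by
    intro v hvi hv
    rw [Complex.im_sum, angleSum_of_im_nonneg hvi]
    simp only [Complex.log_im]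
    rw [Finset.sum_congr rfl fun i _ => arg_neg_I_mul (w := v - r i) (by simpa using hvi)
      (sub_ne_zero_of_prod hc hv i), Finset.sum_sub_distrib]
    simp
  rw [← Finset.mul_sum, Finset.sum_sub_distrib, Complex.mul_im, Complex.sub_re, Complex.sub_im,
    hre z hz, hre w hw, him z hzi hz, him w hwi hw] at hsum
  simpa using hsum

lemma angleSum_ofReal {x : ℝ} :
    angleSum r x = #{i | x < r i} * Real.pi := by
  have : ∀ i, |Complex.arg ((x : ℂ) - r i)| = if x < r i then Real.pi else 0 := by
    intro i
    rw [← Complex.ofReal_sub]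
    split_ifs with h
    · rw [Complex.arg_ofReal_of_neg (by linarith), abs_of_pos Real.pi_pos]
    · rw [Complex.arg_ofReal_of_nonneg (by linarith), abs_zero]
  simp [angleSum, this, ← Finset.sum_filter]

lemma lt_iff_of_angleSum_eq {x y : ℝ} (hxy : x ≤ y) (h : angleSum r x = angleSum r y) (i : ι) :
    x < r i ↔ y < r i := by
  refine ⟨fun hx => ?_, fun hy => hxy.trans_lt hy⟩
  rw [angleSum_ofReal, angleSum_ofReal, mul_left_inj' Real.pi_ne_zero, Nat.cast_inj] at h
  have hsub : ({i | y < r i} : Finset ι) ⊆ ({i | x < r i} : Finset ι) := fun j hj => by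
    simp only [Finset.mem_filter, Finset.mem_univ, true_and] at hj ⊢
    exact hxy.trans_lt hj
  have := Finset.eq_of_subset_of_card_le hsub h.le
  have hi : i ∈ ({i | x < r i} : Finset ι) := by simpa using hx
  rw [← this] at hi
  simpa using hi

end AngleSum

section Multiplicity

lemma ne_of_mem_gap {ι : Type*} {r : ι → ℝ} {x y v : ℝ} (hgap : ∀ i, x < r i ↔ y < r i)
    (hx : ∀ i, x ≠ r i) (hxv : x ≤ v) (hvy : v ≤ y) (i : ι) : v ≠ r i := by
  rintro rfl
  exact absurd ((hgap i).1 (lt_of_le_of_ne hxv (hx i))) (not_lt.2 hvy)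

variable {ι : Type*} [Fintype ι] {r : ι → ℝ} {c : ℝ}

lemma exists_sum_inv_eq_zero {x y : ℝ} (hxy : x < y) (hgap : ∀ i, x < r i ↔ y < r i)
    (hx : ∀ i, x ≠ r i) (hprod : ∏ i, (x - r i) = ∏ i, (y - r i)) :
    ∃ ξ ∈ Set.Ioo x y, ∑ i, (ξ - r i)⁻¹ = 0 := by
  have hne : ∀ v ∈ Set.Icc x y, ∀ i, v - r i ≠ 0 := fun v hv i =>
    sub_ne_zero.2 (ne_of_mem_gap hgap hx hv.1 hv.2 i)
  have hderiv : ∀ v ∈ Set.Icc x y,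
      HasDerivAt (fun v => ∑ i, Real.log (v - r i)) (∑ i, (v - r i)⁻¹) v := by
    intro v hv
    refine HasDerivAt.fun_sum fun i _ => ?_
    simpa using ((hasDerivAt_id v).sub_const (r i)).log (hne v hv i)
  refine exists_hasDerivAt_eq_zero hxy
    (fun v hv => (hderiv v hv).continuousAt.continuousWithinAt) ?_
    (fun v hv => hderiv v ⟨hv.1.le, hv.2.le⟩)
  rw [← Real.log_prod fun i _ => hne x (Set.left_mem_Icc.2 hxy.le) i,
    ← Real.log_prod fun i _ => hne y (Set.right_mem_Icc.2 hxy.le) i, hprod]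

lemma sum_inv_lt_of_gap [Nonempty ι] {x y : ℝ} (hxy : x < y) (hgap : ∀ i, x < r i ↔ y < r i)
    (hx : ∀ i, x ≠ r i) : ∑ i, (y - r i)⁻¹ < ∑ i, (x - r i)⁻¹ := by
  refine Finset.sum_lt_sum_of_nonempty Finset.univ_nonempty fun i _ => ?_
  rcases lt_or_gt_of_ne (hx i) with h | h
  · exact (inv_lt_inv_of_neg (sub_neg.2 ((hgap i).1 h)) (sub_neg.2 h)).2 (by linarith)
  · exact (inv_lt_inv₀ (by linarith) (by linarith)).2 (by linarith)

lemma hasDerivAt_prod_sub {a : ℂ} (ha : ∀ i, a - r i ≠ 0) :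
    HasDerivAt (fun z : ℂ => ∏ i, (z - r i)) ((∏ i, (a - r i)) * ∑ i, (a - r i)⁻¹) a := by
  classical
  have := HasDerivAt.fun_finsetProd (u := Finset.univ) (f := fun (i : ι) (z : ℂ) => z - r i)
    (f' := fun _ => 1) (x := a) fun i _ => (hasDerivAt_id a).sub_const _
  refine this.congr_deriv ?_
  rw [Finset.mul_sum]
  refine Finset.sum_congr rfl fun i _ => ?_
  rw [← Finset.mul_prod_erase _ _ (Finset.mem_univ i), smul_eq_mul]
  field_simp [ha i]

lemma sum_inv_eq_zero_of_double {a : ℂ} {T : ℂ → ℂ} (hc : c ≠ 0) (hT : Differentiable ℂ T)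
    (h : ∀ z : ℂ, ∏ i, (z - r i) = c + (z - a) ^ 2 * T z) : ∑ i, (a - r i)⁻¹ = 0 := by
  have hac : ∏ i, (a - r i) = (c : ℂ) := by simpa using h a
  have h1 := hasDerivAt_prod_sub (sub_ne_zero_of_prod hc hac)
  have h2 : HasDerivAt (fun z : ℂ => (c : ℂ) + (z - a) ^ 2 * T z) 0 a := by
    have := ((((hasDerivAt_id a).sub_const a).pow 2).mul (hT a).hasDerivAt).const_add (c : ℂ)
    simpa using this
  rw [← funext h] at h2
  have := h1.unique h2
  rw [hac] at this
  exact (mul_eq_zero.1 this).resolve_left (Complex.ofReal_ne_zero.2 hc)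

lemma sum_inv_sq_eq_zero_of_triple {a : ℂ} {T : ℂ → ℂ} (hc : c ≠ 0) (hT : Differentiable ℂ T)
    (h : ∀ z : ℂ, ∏ i, (z - r i) = c + (z - a) ^ 3 * T z) : ∑ i, ((a - r i) ^ 2)⁻¹ = 0 := by
  have hac : ∏ i, (a - r i) = (c : ℂ) := by simpa using h a
  have hne := sub_ne_zero_of_prod hc hac
  have hderivT : Differentiable ℂ (deriv T) := hT.deriv
  have hF : Differentiable ℂ fun z : ℂ => ∏ i, (z - r i) := by fun_prop
  have hev : ∀ᶠ z : ℂ in nhds a, ∏ i, (z - r i) ≠ 0 :=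
    hF.continuous.continuousAt.eventually_ne (by
      rw [hac]
      exact Complex.ofReal_ne_zero.2 hc)
  have h1 : HasDerivAt (fun z : ℂ => ∑ i, (z - r i)⁻¹) (∑ i, -((a - (r i : ℂ)) ^ 2)⁻¹) a := by
    refine HasDerivAt.fun_sum fun i _ => ?_
    refine (((hasDerivAt_id a).sub_const (r i : ℂ)).inv (hne i)).congr_deriv ?_
    simp [neg_div]
  have h2 : (fun z : ℂ => ∑ i, (z - r i)⁻¹) =ᶠ[nhds a]
      fun z => (z - a) ^ 2 * ((3 * T z + (z - a) * deriv T z) / ∏ i, (z - r i)) := by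
    filter_upwards [hev] with z hz
    have hz' : ∀ i, z - r i ≠ 0 := fun i => Finset.prod_ne_zero_iff.1 hz i (Finset.mem_univ i)
    have e1 := hasDerivAt_prod_sub hz'
    have e2 := ((((hasDerivAt_id z).sub_const a).pow 3).mul (hT z).hasDerivAt).const_add (c : ℂ)
    have e3 : HasDerivAt (fun z : ℂ => ∏ i, (z - r i)) _ z := (funext h) ▸ e2
    have e4 := e1.unique e3
    rw [← mul_div_assoc, eq_div_iff hz, mul_comm, e4]
    simp
    ring
  have h3 : HasDerivAt
      (fun z => (z - a) ^ 2 * ((3 * T z + (z - a) * deriv T z) / ∏ i, (z - r i))) 0 a := by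
    have hV : DifferentiableAt ℂ
        (fun z => (3 * T z + (z - a) * deriv T z) / ∏ i, (z - r i)) a := by
      refine DifferentiableAt.div (by fun_prop) (hF a) ?_
      rw [hac]
      exact Complex.ofReal_ne_zero.2 hc
    have := (((hasDerivAt_id a).sub_const a).pow 2).mul hV.hasDerivAt
    exact this.congr_deriv (by simp)
  have := h1.unique (h3.congr_of_eventuallyEq h2)
  simpa using this

end Multiplicity

section RootCounting

variable {ι : Type*} [Fintype ι] {r : ι → ℝ} {c : ℝ} {n : ℕ} {lam : Fin n → ℂ}

lemma exists_double_factor {i j : Fin n} (hij : i ≠ j) (he : lam i = lam j)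
    (hQ : ∀ z : ℂ, ∏ j, (z - lam j) = ∏ i, (z - r i) - c) :
    ∃ T : ℂ → ℂ, Differentiable ℂ T ∧ ∀ z : ℂ, ∏ i, (z - r i) = c + (z - lam i) ^ 2 * T z := by
  refine ⟨fun z => ∏ k ∈ (Finset.univ.erase i).erase j, (z - lam k), by fun_prop, fun z => ?_⟩
  have := hQ z
  rw [← Finset.mul_prod_erase _ _ (Finset.mem_univ i), ← Finset.mul_prod_erase (Finset.univ.erase i)
    _ (Finset.mem_erase.2 ⟨hij.symm, Finset.mem_univ j⟩), ← he] at this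
  linear_combination -this

lemma exists_triple_factor {i j l : Fin n} (hij : i ≠ j) (hil : i ≠ l) (hjl : j ≠ l)
    (he : lam i = lam j) (he' : lam i = lam l)
    (hQ : ∀ z : ℂ, ∏ j, (z - lam j) = ∏ i, (z - r i) - c) :
    ∃ T : ℂ → ℂ, Differentiable ℂ T ∧ ∀ z : ℂ, ∏ i, (z - r i) = c + (z - lam i) ^ 3 * T z := by
  refine ⟨fun z => ∏ k ∈ ((Finset.univ.erase i).erase j).erase l, (z - lam k), by fun_prop,
    fun z => ?_⟩
  have := hQ z
  rw [← Finset.mul_prod_erase _ _ (Finset.mem_univ i), ← Finset.mul_prod_erase (Finset.univ.erase i)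
    _ (Finset.mem_erase.2 ⟨hij.symm, Finset.mem_univ j⟩),
    ← Finset.mul_prod_erase ((Finset.univ.erase i).erase j) _ (Finset.mem_erase.2 ⟨hjl.symm,
      Finset.mem_erase.2 ⟨hil.symm, Finset.mem_univ l⟩⟩), ← he, ← he'] at this
  linear_combination -this

lemma prod_root_sub (hQ : ∀ z : ℂ, ∏ j, (z - lam j) = ∏ i, (z - r i) - c) (j : Fin n) :
    ∏ i, (lam j - r i) = (c : ℂ) := by
  have := hQ (lam j)
  rw [Finset.prod_eq_zero (Finset.mem_univ j) (sub_self _)] at this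
  exact (sub_eq_zero.1 this.symm)

lemma im_eq_zero_of_double [Nonempty ι] (hc : c ≠ 0) {i j : Fin n} (hij : i ≠ j)
    (he : lam i = lam j) (hQ : ∀ z : ℂ, ∏ j, (z - lam j) = ∏ i, (z - r i) - c) :
    (lam i).im = 0 := by
  obtain ⟨T, hT, h⟩ := exists_double_factor hij he hQ
  have h0 := congrArg Complex.im (sum_inv_eq_zero_of_double hc hT h)
  simp only [Complex.im_sum, Complex.inv_im, Complex.sub_im, Complex.ofReal_im, sub_zero,
    Complex.zero_im, neg_div] at h0
  rw [Finset.sum_neg_distrib, neg_eq_zero] at h0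
  simp only [div_eq_mul_inv] at h0
  rw [← Finset.mul_sum] at h0
  refine (mul_eq_zero.1 h0).resolve_right (Finset.sum_pos (fun k _ => inv_pos.2 ?_)
    Finset.univ_nonempty).ne'
  exact Complex.normSq_pos.2 (sub_ne_zero_of_prod hc (prod_root_sub hQ i) k)

lemma eq_ofReal_re {z : ℂ} (hz : z.im = 0) : z = (z.re : ℂ) :=
  Complex.ext rfl (by simpa using hz)

lemma re_ne_of_root (hc : c ≠ 0) (hQ : ∀ z : ℂ, ∏ j, (z - lam j) = ∏ i, (z - r i) - c)
    {j : Fin n} (hj : (lam j).im = 0) (i : ι) : (lam j).re ≠ r i := fun h =>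
  sub_ne_zero_of_prod hc (prod_root_sub hQ j) i (by rw [eq_ofReal_re hj, h, sub_self])

lemma prod_re_sub (hQ : ∀ z : ℂ, ∏ j, (z - lam j) = ∏ i, (z - r i) - c)
    {j : Fin n} (hj : (lam j).im = 0) : ∏ i, ((lam j).re - r i) = c := by
  have := prod_root_sub hQ j
  rw [eq_ofReal_re hj] at this
  exact_mod_cast this

lemma lt_iff_of_roots {i j : Fin n}
    (hi : (lam i).im = 0) (hj : (lam j).im = 0) (hang : angleSum r (lam i) = angleSum r (lam j))
    (hle : (lam i).re ≤ (lam j).re) (k : ι) : (lam i).re < r k ↔ (lam j).re < r k := by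
  rw [eq_ofReal_re hi, eq_ofReal_re hj] at hang
  exact lt_iff_of_angleSum_eq hle hang k

lemma exists_critical (hc : c ≠ 0) (hQ : ∀ z : ℂ, ∏ j, (z - lam j) = ∏ i, (z - r i) - c)
    {i j : Fin n} (hij : i ≠ j) (hi : (lam i).im = 0) (hj : (lam j).im = 0)
    (hang : angleSum r (lam i) = angleSum r (lam j)) (hle : (lam i).re ≤ (lam j).re) :
    ∃ ξ : ℝ, (lam i).re ≤ ξ ∧ ξ ≤ (lam j).re ∧ ∑ k, (ξ - r k)⁻¹ = 0 ∧
      ((lam i).re < (lam j).re → (lam i).re < ξ ∧ ξ < (lam j).re) := by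
  rcases hle.lt_or_eq with hlt | heq
  · obtain ⟨ξ, hξ, h0⟩ := exists_sum_inv_eq_zero hlt (lt_iff_of_roots hi hj hang hle)
      (re_ne_of_root hc hQ hi) ((prod_re_sub hQ hi).trans (prod_re_sub hQ hj).symm)
    exact ⟨ξ, hξ.1.le, hξ.2.le, h0, fun _ => hξ⟩
  · refine ⟨(lam i).re, le_rfl, hle, ?_, fun h => absurd h heq.not_lt⟩
    obtain ⟨T, hT, h⟩ := exists_double_factor hij
      ((eq_ofReal_re hi).trans ((congrArg _ heq).trans (eq_ofReal_re hj).symm)) hQ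
    have h0 := sum_inv_eq_zero_of_double hc hT h
    rw [eq_ofReal_re hi] at h0
    exact_mod_cast h0

lemma not_three_real_roots [Nonempty ι] (hc : c ≠ 0)
    (hQ : ∀ z : ℂ, ∏ j, (z - lam j) = ∏ i, (z - r i) - c)
    {i j l : Fin n} (hij : i ≠ j) (hil : i ≠ l) (hjl : j ≠ l) (hi : (lam i).im = 0)
    (hj : (lam j).im = 0) (hl : (lam l).im = 0) (hang : angleSum r (lam i) = angleSum r (lam j))
    (hang' : angleSum r (lam j) = angleSum r (lam l)) (hle : (lam i).re ≤ (lam j).re)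
    (hle' : (lam j).re ≤ (lam l).re) : False := by
  obtain ⟨ξ, h1, h2, h3, h4⟩ := exists_critical hc hQ hij hi hj hang hle
  obtain ⟨η, k1, k2, k3, k4⟩ := exists_critical hc hQ hjl hj hl hang' hle'
  have hgap := lt_iff_of_roots hi hl (hang.trans hang') (hle.trans hle')
  have hx := re_ne_of_root hc hQ hi
  have hξη : ξ = η := by
    by_contra hne
    have hlt : ξ < η := lt_of_le_of_ne (h2.trans k1) hne
    have := sum_inv_lt_of_gap (r := r) hlt
      (fun k => ⟨fun h => k2.trans_lt ((hgap k).1 (h1.trans_lt h)), fun h => hlt.trans h⟩)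
      (ne_of_mem_gap hgap hx h1 (h2.trans hle'))
    rw [h3, k3] at this
    exact lt_irrefl _ this
  have hξ : ξ = (lam j).re := le_antisymm h2 (hξη ▸ k1)
  have e1 : (lam i).re = (lam j).re :=
    hle.lt_or_eq.resolve_left fun h => ((h4 h).2.ne hξ)
  have e2 : (lam j).re = (lam l).re :=
    hle'.lt_or_eq.resolve_left fun h => ((k4 h).1.ne (hξη ▸ hξ.symm))
  obtain ⟨T, hT, h⟩ := exists_triple_factor hij hil hjl
    (Complex.ext e1 (hi.trans hj.symm)) (Complex.ext (e1.trans e2) (hi.trans hl.symm)) hQ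
  have h0 := sum_inv_sq_eq_zero_of_triple hc hT h
  rw [eq_ofReal_re hi] at h0
  have h0' : ∑ k, (((lam i).re - r k) ^ 2)⁻¹ = 0 := by exact_mod_cast h0
  exact (Finset.sum_pos (fun k _ => inv_pos.2 (sq_pos_of_ne_zero (sub_ne_zero.2 (hx k))))
    Finset.univ_nonempty).ne' h0'

lemma angleSum_eq_of_nonreal [Nonempty ι] (hc : c ≠ 0)
    (hQ : ∀ z : ℂ, ∏ j, (z - lam j) = ∏ i, (z - r i) - c) {i j : Fin n}
    (hi : (lam i).im ≠ 0) (hang : angleSum r (lam i) = angleSum r (lam j)) :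
    lam j = lam i ∨ lam j = conj (lam i) := by
  by_contra! h
  have := re_sub_mul_angleSum_sub_neg hc (prod_root_sub hQ i) (prod_root_sub hQ j) hi h.1 h.2
  rw [hang, sub_self, mul_zero] at this
  exact lt_irrefl _ this

lemma not_three_roots_of_nonreal [Nonempty ι] (hc : c ≠ 0)
    (hQ : ∀ z : ℂ, ∏ j, (z - lam j) = ∏ i, (z - r i) - c)
    {i j l : Fin n} (hij : i ≠ j) (hil : i ≠ l) (hjl : j ≠ l) (hi : (lam i).im ≠ 0)
    (hang : angleSum r (lam i) = angleSum r (lam j))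
    (hang' : angleSum r (lam i) = angleSum r (lam l)) : False := by
  rcases angleSum_eq_of_nonreal hc hQ hi hang with h | h
  · exact hi (im_eq_zero_of_double hc hij h.symm hQ)
  rcases angleSum_eq_of_nonreal hc hQ hi hang' with h' | h'
  · exact hi (im_eq_zero_of_double hc hil h'.symm hQ)
  · have := im_eq_zero_of_double hc hjl (h.trans h'.symm) hQ
    rw [h] at this
    exact hi (by simpa using this)

/-- At most two roots share the same angle sum. -/
lemma not_three_roots [Nonempty ι] (hc : c ≠ 0)
    (hQ : ∀ z : ℂ, ∏ j, (z - lam j) = ∏ i, (z - r i) - c)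
    {i j l : Fin n} (hij : i ≠ j) (hil : i ≠ l) (hjl : j ≠ l)
    (hang : angleSum r (lam i) = angleSum r (lam j))
    (hang' : angleSum r (lam i) = angleSum r (lam l)) : False := by
  by_cases hi : (lam i).im = 0
  swap
  · exact not_three_roots_of_nonreal hc hQ hij hil hjl hi hang hang'
  by_cases hj : (lam j).im = 0
  swap
  · exact not_three_roots_of_nonreal hc hQ hij.symm hjl hil hj hang.symm (hang.symm.trans hang')
  by_cases hl : (lam l).im = 0
  swap
  · exact not_three_roots_of_nonreal hc hQ hil.symm hjl.symm hij hl hang'.symm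
      (hang'.symm.trans hang)
  have hang'' := hang.symm.trans hang'
  have h3 := @not_three_real_roots ι _ r c n lam _ hc hQ
  rcases le_total (lam i).re (lam j).re with h | h <;>
    rcases le_total (lam j).re (lam l).re with h' | h' <;>
      rcases le_total (lam i).re (lam l).re with h'' | h''
  · exact h3 hij hil hjl hi hj hl hang hang'' h h'
  · exact h3 hij hil hjl hi hj hl hang hang'' h h'
  · exact h3 hil hij hjl.symm hi hl hj hang' hang''.symm h'' h'
  · exact h3 hil.symm hjl.symm hij hl hi hj hang'.symm hang h'' h
  · exact h3 hij.symm hjl hil hj hi hl hang.symm hang' h h''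
  · exact h3 hjl hij.symm hil.symm hj hl hi hang'' hang'.symm h' h''
  · exact h3 hjl.symm hil.symm hij.symm hl hj hi hang''.symm hang.symm h' h
  · exact h3 hjl.symm hil.symm hij.symm hl hj hi hang''.symm hang.symm h' h

lemma not_two_roots_zero [Nonempty ι] (hc : c ≠ 0)
    (hQ : ∀ z : ℂ, ∏ j, (z - lam j) = ∏ i, (z - r i) - c) {i j : Fin n} (hij : i ≠ j)
    (hi : angleSum r (lam i) = 0) (hj : angleSum r (lam j) = 0) : False := by
  wlog hle : (lam i).re ≤ (lam j).re generalizing i j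
  · exact this hij.symm hj hi (not_le.1 hle).le
  have him : ∀ {k}, angleSum r (lam k) = 0 → (lam k).im = 0 := fun h =>
    by_contra fun h' => (angleSum_pos h').ne' h
  obtain ⟨ξ, h1, -, h3, -⟩ := exists_critical hc hQ hij (him hi) (him hj) (hi.trans hj.symm) hle
  have hlt : ∀ k, r k < (lam i).re := by
    intro k
    have h := hi
    rw [eq_ofReal_re (him hi), angleSum_ofReal] at h
    have h' := (mul_eq_zero.1 h).resolve_right Real.pi_ne_zero
    rw [Nat.cast_eq_zero, Finset.card_eq_zero, Finset.filter_eq_empty_iff] at h'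
    exact lt_of_le_of_ne (not_lt.1 (h' (Finset.mem_univ k))) (re_ne_of_root hc hQ (him hi) k).symm
  exact (Finset.sum_pos (fun k _ => inv_pos.2 (by linarith [hlt k]))
    Finset.univ_nonempty).ne' h3

lemma not_two_roots_card [Nonempty ι] (hc : c ≠ 0)
    (hQ : ∀ z : ℂ, ∏ j, (z - lam j) = ∏ i, (z - r i) - c) {i j : Fin n} (hij : i ≠ j)
    (hi : angleSum r (lam i) = Fintype.card ι * Real.pi)
    (hj : angleSum r (lam j) = Fintype.card ι * Real.pi) : False := by
  wlog hle : (lam i).re ≤ (lam j).re generalizing i j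
  · exact this hij.symm hj hi (not_le.1 hle).le
  have him : ∀ {k}, angleSum r (lam k) = Fintype.card ι * Real.pi → (lam k).im = 0 := fun h =>
    by_contra fun h' => (angleSum_lt h').ne h
  obtain ⟨ξ, -, h2, h3, -⟩ := exists_critical hc hQ hij (him hi) (him hj) (hi.trans hj.symm) hle
  have hlt : ∀ k, (lam j).re < r k := by
    intro k
    have h := hj
    rw [eq_ofReal_re (him hj), angleSum_ofReal, mul_left_inj' Real.pi_ne_zero, Nat.cast_inj,
      Finset.card_eq_iff_eq_univ] at h
    simpa using h.symm.subset (Finset.mem_univ k)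
  exact (Finset.sum_neg (fun k _ => inv_lt_zero.2 (by linarith [hlt k]))
    Finset.univ_nonempty).ne h3

end RootCounting

section LabelCounting

variable {α : Type*} [Fintype α] {a : α → ℕ}

lemma card_label_lt_le (h2 : ∀ t, #{j | a j = t} ≤ 2) (h0 : #{j | a j = 0} ≤ 1) (m : ℕ) :
    #{j | a j < m + 1} ≤ 2 * m + 1 := by
  classical
  induction m with
  | zero => simpa using h0
  | succ m ih =>
    have hsub : ({j | a j < m + 1 + 1} : Finset α) ⊆
        ({j | a j < m + 1} : Finset α) ∪ ({j | a j = m + 1} : Finset α) := by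
      intro j
      simp only [Finset.mem_filter, Finset.mem_univ, true_and, Finset.mem_union]
      omega
    have := (Finset.card_le_card hsub).trans (Finset.card_union_le _ _)
    have := h2 (m + 1)
    omega

lemma card_lt_label_le {n : ℕ} (h2 : ∀ t, #{j | a j = t} ≤ 2) (hle : ∀ j, 2 * a j ≤ n)
    (hn : ∀ t, 2 * t = n → #{j | a j = t} ≤ 1) (d m : ℕ) (hd : 2 * m + d + 1 = n) :
    #{j | m < a j} ≤ d := by
  classical
  induction d using Nat.strong_induction_on generalizing m with
  | _ d ih =>
    have hsub : ({j | m < a j} : Finset α) ⊆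
        ({j | m + 1 < a j} : Finset α) ∪ ({j | a j = m + 1} : Finset α) := by
      intro j
      simp only [Finset.mem_filter, Finset.mem_univ, true_and, Finset.mem_union]
      omega
    have hcard := (Finset.card_le_card hsub).trans (Finset.card_union_le _ _)
    have hempty : d < 2 → #{j | m + 1 < a j} = 0 := fun h => by
      rw [Finset.card_eq_zero, Finset.filter_eq_empty_iff]
      intro j _
      have := hle j
      omega
    have h2m := h2 (m + 1)
    match d, hd with
    | 0, hd =>
      rw [Nat.le_zero, Finset.card_eq_zero, Finset.filter_eq_empty_iff]
      intro j _
      have := hle j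
      omega
    | 1, hd =>
      have := hempty (by norm_num)
      have := hn (m + 1) (by omega)
      omega
    | d + 2, hd =>
      have := ih d (by omega) (m + 1) (by omega)
      omega

end LabelCounting

/-- The position of a nonreal solution of `∏ i, (z - r i) = c` in the list of all solutions,
sorted by decreasing real part, is determined by its angle sum. -/
theorem index_eq_of_angleSum {ι : Type*} [Fintype ι] {r : ι → ℝ} {c : ℝ} {n : ℕ}
    {lam : Fin n → ℂ} (hcard : Fintype.card ι = n) (hc : 0 < c)
    (hQ : ∀ z : ℂ, ∏ j, (z - lam j) = ∏ i, (z - r i) - c)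
    (hsort : ∀ i j : Fin n, i ≤ j → (lam j).re ≤ (lam i).re) (k : Fin n) (hk : (lam k).im ≠ 0) :
    angleSum r (lam k) = 2 * Real.pi * (((k : ℕ) + 1) / 2 : ℕ) ∧ 0 < ((k : ℕ) + 1) / 2 ∧
      2 * (((k : ℕ) + 1) / 2) < n := by
  have hpi := Real.pi_pos
  have : Nonempty ι := Fintype.card_pos_iff.1 (by have := k.2; omega)
  choose a ha using fun j => exists_angleSum_eq hc (prod_root_sub hQ j)
  have hinj : ∀ i j, a i = a j → angleSum r (lam i) = angleSum r (lam j) := fun i j h => by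
    rw [ha, ha, h]
  have h2 : ∀ t, #{j | a j = t} ≤ 2 := by
    intro t
    by_contra! h
    obtain ⟨i, j, l, hi, hj, hl, hij, hil, hjl⟩ := Finset.two_lt_card_iff.1 h
    simp only [Finset.mem_filter, Finset.mem_univ, true_and] at hi hj hl
    exact not_three_roots hc.ne' hQ hij hil hjl (hinj _ _ (hi.trans hj.symm))
      (hinj _ _ (hi.trans hl.symm))
  have h0 : #{j | a j = 0} ≤ 1 := by
    rw [Finset.card_le_one]
    intro i hi j hj
    simp only [Finset.mem_filter, Finset.mem_univ, true_and] at hi hj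
    by_contra hij
    exact not_two_roots_zero hc.ne' hQ hij (by rw [ha, hi]; simp) (by rw [ha, hj]; simp)
  have hn : ∀ t, 2 * t = n → #{j | a j = t} ≤ 1 := by
    intro t ht
    rw [Finset.card_le_one]
    intro i hi j hj
    simp only [Finset.mem_filter, Finset.mem_univ, true_and] at hi hj
    by_contra hij
    refine not_two_roots_card hc.ne' hQ hij ?_ ?_
    · rw [ha, hi, hcard, ← ht]; push_cast; ring
    · rw [ha, hj, hcard, ← ht]; push_cast; ring
  have hle : ∀ j, 2 * a j ≤ n := by
    intro j
    have := angleSum_le (r := r) (z := lam j)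
    rw [ha, hcard] at this
    have h' : (2 * a j : ℝ) ≤ n := le_of_mul_le_mul_right (by linarith) hpi
    exact_mod_cast h'
  have hlt : 2 * a k < n := by
    have := angleSum_lt (r := r) hk
    rw [ha, hcard] at this
    have h' : (2 * a k : ℝ) < n := lt_of_mul_lt_mul_right (by linarith) hpi.le
    exact_mod_cast h'
  have hpos : 0 < a k := by
    have := angleSum_pos (r := r) hk
    rw [ha] at this
    exact_mod_cast pos_of_mul_pos_right this (by positivity)
  have hcmp : ∀ j, a k ≠ a j → ((lam k).re - (lam j).re) * ((a k : ℝ) - a j) < 0 := by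
    intro j hj
    have := re_sub_mul_angleSum_sub_neg hc.ne' (prod_root_sub hQ k) (prod_root_sub hQ j) hk
      (fun h => hj ?_) (fun h => hj ?_)
    · rw [ha, ha, ← mul_sub] at this
      nlinarith
    all_goals
      have h' : angleSum r (lam j) = angleSum r (lam k) := by
        simp only [h, angleSum_conj]
      rw [ha, ha] at h'
      exact_mod_cast (mul_left_cancel₀ (by positivity) h').symm
  have hbefore : ∀ j, j ≤ k → a j < a k + 1 := by
    intro j hj
    by_contra! h
    have h1 := hcmp j (by omega)
    have h2 := hsort j k hj
    have h3 : (a k : ℝ) ≤ a j := by exact_mod_cast (by omega : a k ≤ a j)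
    nlinarith [mul_nonneg (sub_nonneg.2 h2) (sub_nonneg.2 h3)]
  have hafter : ∀ j, k ≤ j → a k ≤ a j := by
    intro j hj
    by_contra! h
    have h1 := hcmp j (by omega)
    have h2 := hsort k j hj
    have h3 : (a j : ℝ) ≤ a k := by exact_mod_cast h.le
    nlinarith [mul_nonneg (sub_nonneg.2 h2) (sub_nonneg.2 h3)]
  have c1 : (k : ℕ) + 1 ≤ 2 * a k + 1 := by
    rw [← Fin.card_Iic]
    refine (Finset.card_le_card fun j hj => ?_).trans (card_label_lt_le h2 h0 (a k))
    simpa using hbefore j (Finset.mem_Iic.1 hj)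
  have c2 : n - (k : ℕ) ≤ n - 2 * a k + 1 := by
    rw [← Fin.card_Ici]
    refine (Finset.card_le_card (t := {j | a k - 1 < a j}) fun j hj => ?_).trans
      (card_lt_label_le h2 hle hn _ _ (by omega))
    have := hafter j (Finset.mem_Ici.1 hj)
    simp
    omega
  have hak : a k = ((k : ℕ) + 1) / 2 := by
    have := k.2
    omega
  rw [← hak]
  exact ⟨ha k, hpos, hlt⟩

section ArgSum

variable {ι : Type*} [Fintype ι] [DecidableEq ι]

lemma det_smul_one_add_smul (M : Matrix ι ι ℂ) (a b : ℂ) :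
    (a • (1 : Matrix ι ι ℂ) + b • M).det = (M.charpoly.roots.map fun w => a + b * w).prod := by
  have hcard : M.charpoly.roots.card = Fintype.card ι := by
    rw [Polynomial.splits_iff_card_roots.1 (IsAlgClosed.splits _), charpoly_natDegree_eq_dim]
  rcases eq_or_ne b 0 with rfl | hb
  · simp [hcard]
  · have h1 : a • (1 : Matrix ι ι ℂ) + b • M = (-b) • (Matrix.scalar ι (-(a / b)) - M) := by
      ext i j
      simp only [Matrix.add_apply, Matrix.smul_apply, Matrix.sub_apply, Matrix.scalar_apply,
        Matrix.one_apply, Matrix.diagonal_apply, smul_eq_mul]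
      split_ifs <;> field_simp <;> ring
    rw [h1, det_smul, ← eval_charpoly, (IsAlgClosed.splits _).eval_eq_prod_roots_of_monic
      (charpoly_monic M), ← hcard, ← Multiset.prod_replicate, ← Multiset.map_const',
      ← Multiset.prod_map_mul]
    congr 1
    refine Multiset.map_congr rfl fun w _ => ?_
    field_simp
    ring

lemma exp_sum_log {s : Multiset ℂ} (h : ∀ w ∈ s, w ≠ 0) :
    Complex.exp (s.map Complex.log).sum = s.prod := by
  rw [Complex.exp_multiset_sum, Multiset.map_map]
  congr 1
  conv_rhs => rw [← Multiset.map_id s]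
  exact Multiset.map_congr rfl fun w hw => Complex.exp_log (h w hw)

lemma eq_of_exp_eq_one_of_continuousOn {D : ℝ → ℂ} (hD : ContinuousOn D (Set.Icc 0 1))
    (h : ∀ σ ∈ Set.Icc (0 : ℝ) 1, Complex.exp (D σ) = 1) : D 1 = D 0 := by
  have hc : (Set.range fun m : ℤ => (m : ℂ) * (2 * Real.pi * Complex.I)).Countable :=
    Set.countable_range _
  refine hc.isTotallyDisconnected _ ?_ (isPreconnected_Icc.image D hD)
    (Set.mem_image_of_mem D (Set.right_mem_Icc.2 zero_le_one))
    (Set.mem_image_of_mem D (Set.left_mem_Icc.2 zero_le_one))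
  rintro _ ⟨σ, hσ, rfl⟩
  obtain ⟨m, hm⟩ := Complex.exp_eq_one_iff.1 (h σ hσ)
  exact ⟨m, hm.symm⟩

/-- Along a path of matrices with spectrum in the right half plane whose determinant stays on a
ray, the sum of the arguments of the eigenvalues is constant. -/
theorem sum_arg_roots_eq {X : Type*} [TopologicalSpace X] [PreconnectedSpace X]
    {W : X → Matrix ι ι ℂ} (hW : Continuous W) (hre : ∀ x, ∀ w ∈ (W x).charpoly.roots, 0 < w.re)
    {κ : ℂ} (hdet : ∀ x, ∃ t : ℝ, 0 < t ∧ (W x).det = t * κ) (x y : X) :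
    ((W x).charpoly.roots.map Complex.arg).sum = ((W y).charpoly.roots.map Complex.arg).sum := by
  have hslit : ∀ σ ∈ Set.Icc (0 : ℝ) 1, ∀ x, ∀ w ∈ (W x).charpoly.roots,
      (1 - σ : ℂ) + σ * w ∈ Complex.slitPlane := by
    rintro σ ⟨h0, h1⟩ x w hw
    left
    simp only [Complex.add_re, Complex.sub_re, Complex.one_re, Complex.ofReal_re,
      Complex.re_ofReal_mul]
    rcases h0.lt_or_eq with h | rfl
    · exact add_pos_of_nonneg_of_pos (sub_nonneg.2 h1) (mul_pos h (hre x w hw))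
    · simp
  set P : X × ℝ → ℂ := fun p => ((1 - p.2 : ℂ) • (1 : Matrix ι ι ℂ) + (p.2 : ℂ) • W p.1).det
    with hP
  have hPc : Continuous P := by
    refine Continuous.matrix_det ?_
    have := hW.comp continuous_fst (Y := X) (X := X × ℝ)
    fun_prop
  set E : X × ℝ → ℂ := fun p =>
    ((W p.1).charpoly.roots.map fun w => Complex.log ((1 - p.2 : ℂ) + p.2 * w)).sum with hE
  have hexp : ∀ x, ∀ σ ∈ Set.Icc (0 : ℝ) 1, Complex.exp (E (x, σ)) = P (x, σ) := by
    intro x σ hσ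
    simp only [hE, hP]
    rw [det_smul_one_add_smul, ← exp_sum_log, Multiset.map_map]
    · rfl
    · intro v hv
      obtain ⟨w, hw, rfl⟩ := Multiset.mem_map.1 hv
      exact Complex.slitPlane_ne_zero (hslit σ hσ x w hw)
  have hEc : ∀ x, ContinuousOn (fun σ => E (x, σ)) (Set.Icc 0 1) := by
    intro x
    refine continuousOn_multiset_sum (f := fun (w : ℂ) (σ : ℝ) => Complex.log ((1 - σ : ℂ) + σ * w))
      (W x).charpoly.roots fun w hw => ?_
    have : Continuous fun σ : ℝ => (1 - σ : ℂ) + σ * w := by fun_prop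
    refine this.continuousOn.clog fun σ hσ => hslit σ hσ x w hw
  have hP0 : ∀ x, ∀ σ ∈ Set.Icc (0 : ℝ) 1, P (x, σ) ≠ 0 := fun x σ hσ =>
    hexp x σ hσ ▸ Complex.exp_ne_zero _
  suffices h : IsLocallyConstant fun x => ((W x).charpoly.roots.map Complex.arg).sum from
    h.apply_eq_of_preconnectedSpace x y
  rw [IsLocallyConstant.iff_eventually_eq]
  intro x₀
  have hev : ∀ᶠ x in nhds x₀, ∀ σ ∈ Set.Icc (0 : ℝ) 1,
      P (x, σ) / P (x₀, σ) ∈ Complex.slitPlane := by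
    refine isCompact_Icc.eventually_forall_of_forall_eventually fun σ hσ => ?_
    have hcont : ContinuousAt (fun p : X × ℝ => P p / P (x₀, p.2)) (x₀, σ) :=
      hPc.continuousAt.div (by fun_prop) (hP0 x₀ σ hσ)
    refine hcont.eventually_mem (Complex.isOpen_slitPlane.mem_nhds ?_)
    rw [div_self (hP0 x₀ σ hσ)]
    exact Complex.one_mem_slitPlane
  filter_upwards [hev] with x hx
  have hone := eq_of_exp_eq_one_of_continuousOn
    (D := fun σ => E (x, σ) - E (x₀, σ) - Complex.log (P (x, σ) / P (x₀, σ)))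
    (((hEc x).sub (hEc x₀)).sub (ContinuousOn.clog
      ((by fun_prop : Continuous fun σ : ℝ => P (x, σ)).continuousOn.div
        (by fun_prop : Continuous fun σ : ℝ => P (x₀, σ)).continuousOn (hP0 x₀)) hx)) (by
      intro σ hσ
      have h1 := hP0 x σ hσ
      have h2 := hP0 x₀ σ hσ
      rw [Complex.exp_sub, Complex.exp_sub, hexp x σ hσ, hexp x₀ σ hσ,
        Complex.exp_log (div_ne_zero h1 h2), div_self (div_ne_zero h1 h2)])
  have hzero : ∀ x, E (x, 0) = 0 := by simp [hE]
  have hP1 : ∀ x, P (x, 1) = (W x).det := by simp [hP]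
  have hP0' : ∀ x, P (x, 0) = 1 := by simp [hP]
  have him : ∀ x, (E (x, 1)).im = ((W x).charpoly.roots.map Complex.arg).sum := by
    intro x
    simp only [hE, Complex.ofReal_one, sub_self, zero_add, one_mul]
    change Complex.imAddGroupHom _ = _
    rw [map_multiset_sum, Multiset.map_map]
    exact congrArg _ (Multiset.map_congr rfl fun w _ => Complex.log_im w)
  have hlog : (Complex.log (P (x, 1) / P (x₀, 1))).im = 0 := by
    obtain ⟨t, ht, e⟩ := hdet x
    obtain ⟨t₀, ht₀, e₀⟩ := hdet x₀
    have hκ : κ ≠ 0 := by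
      rintro rfl
      refine hP0 x₀ 1 (Set.right_mem_Icc.2 zero_le_one) ?_
      rw [hP1, e₀, mul_zero]
    rw [hP1, hP1, e, e₀, mul_div_mul_right _ _ hκ, ← Complex.ofReal_div, Complex.log_im,
      Complex.arg_ofReal_of_nonneg (div_pos ht ht₀).le]
  have h := congrArg Complex.im hone
  simp only [hzero, hP0', Complex.sub_im, him, hlog] at h
  simpa [sub_eq_zero] using h

end ArgSum

section CharpolyRoots

variable {ι : Type*} [Fintype ι] [DecidableEq ι]

lemma roots_charpoly_smul_one_add_smul (M : Matrix ι ι ℂ) (a b : ℂ) :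
    (a • (1 : Matrix ι ι ℂ) + b • M).charpoly.roots = M.charpoly.roots.map fun w => a + b * w := by
  rw [← Polynomial.roots_multiset_prod_X_sub_C (M.charpoly.roots.map fun w => a + b * w)]
  congr 1
  refine Polynomial.funext fun x => ?_
  have h : Matrix.scalar ι x - (a • (1 : Matrix ι ι ℂ) + b • M) =
      (x - a) • (1 : Matrix ι ι ℂ) + (-b) • M := by
    ext i j
    simp only [Matrix.add_apply, Matrix.smul_apply, Matrix.sub_apply, Matrix.scalar_apply,
      Matrix.one_apply, Matrix.diagonal_apply, smul_eq_mul]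
    split_ifs <;> ring
  rw [eval_charpoly, h, det_smul_one_add_smul, Polynomial.eval_multiset_prod, Multiset.map_map,
    Multiset.map_map]
  congr 1
  refine Multiset.map_congr rfl fun w _ => ?_
  simp
  ring

lemma roots_charpoly_diagonal (d : ι → ℂ) :
    (Matrix.diagonal d).charpoly.roots = Finset.univ.val.map d := by
  rw [charpoly_diagonal]
  have := Polynomial.roots_multiset_prod_X_sub_C (Finset.univ.val.map d)
  rwa [Multiset.map_map] at this

lemma exists_eigenvector_of_mem_roots {M : Matrix ι ι ℂ} {w : ℂ} (hw : w ∈ M.charpoly.roots) :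
    ∃ v ≠ 0, M *ᵥ v = w • v := by
  have h0 := (Polynomial.mem_roots'.1 hw).2
  rw [Polynomial.IsRoot.def, eval_charpoly] at h0
  obtain ⟨v, hv, h⟩ := exists_mulVec_eq_zero_iff.2 h0
  refine ⟨v, hv, ?_⟩
  rw [sub_mulVec, sub_eq_zero] at h
  rw [← h]
  ext i
  simp [Matrix.scalar_apply, mulVec_diagonal]

end CharpolyRoots

namespace periodicJacobi

variable {n : ℕ}

lemma zero_offDiag (hn : 3 ≤ n) (a : ZMod n → ℂ) :
    periodicJacobi n a 0 0 = Matrix.diagonal a := by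
  ext i j
  rw [periodicJacobi, Matrix.of_apply, Matrix.diagonal_apply]
  by_cases h1 : j = i + 1
  · simp [h1, (add_one_ne_self hn i).symm]
  · by_cases h2 : j = i - 1
    · simp [h2, (sub_one_ne_self hn i).symm]
    · simp [h1, h2, eq_comm]

/-- If the off-diagonal part is Hermitian and the diagonal lies in the upper half plane, then so
does the spectrum. -/
lemma re_pos_of_mem_roots [NeZero n] (hn : 3 ≤ n) {a : ZMod n → ℂ} (ha : ∀ i, 0 < (a i).im)
    (s : ZMod n → ℝ) {w : ℂ}
    (hw : w ∈ (-Complex.I • periodicJacobi n a (fun i => s i)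
      (fun i => s (i - 1))).charpoly.roots) : 0 < w.re := by
  obtain ⟨v, hv, h⟩ := exists_eigenvector_of_mem_roots hw
  have hi : ∀ i, a i * v i - s i * v (i + 1) - s (i - 1) * v (i - 1) = Complex.I * w * v i := by
    intro i
    have := congrFun h i
    rw [smul_mulVec, Pi.smul_apply, mulVec_apply hn, Pi.smul_apply, smul_eq_mul,
      smul_eq_mul] at this
    linear_combination Complex.I * this + (a i * v i - s i * v (i + 1) - s (i - 1) * v (i - 1)) *
      Complex.I_mul_I
  have h1 : ∀ i, (a i).im * Complex.normSq (v i) - s i * (conj (v i) * v (i + 1)).im +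
      s (i - 1) * (conj (v (i - 1)) * v i).im = w.re * Complex.normSq (v i) := by
    intro i
    have := congrArg Complex.im (congrArg (conj (v i) * ·) (hi i))
    simp [Complex.normSq_apply] at this ⊢
    linarith
  have h2 := Finset.sum_congr (rfl : (Finset.univ : Finset (ZMod n)) = _) fun i _ => h1 i
  rw [Finset.sum_add_distrib, Finset.sum_sub_distrib, ← Finset.mul_sum,
    ← Equiv.sum_comp (Equiv.addRight (1 : ZMod n))
      fun i => s (i - 1) * (conj (v (i - 1)) * v i).im] at h2
  simp only [Equiv.coe_addRight, add_sub_cancel_right, sub_add_cancel] at h2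
  obtain ⟨j, hj⟩ := Function.ne_iff.1 hv
  have hj' : 0 < Complex.normSq (v j) := Complex.normSq_pos.2 hj
  have hpos : 0 < ∑ i, (a i).im * Complex.normSq (v i) :=
    Finset.sum_pos' (fun i _ => mul_nonneg (ha i).le (Complex.normSq_nonneg _))
      ⟨j, Finset.mem_univ j, mul_pos (ha j) hj'⟩
  rw [h2] at hpos
  exact pos_of_mul_pos_left hpos (Finset.sum_nonneg fun i _ => Complex.normSq_nonneg _)

end periodicJacobi

/-- The Hermitian matrix with the diagonal of the unicyclic generator whose off-diagonal entries
are the geometric means of opposite rates. -/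
noncomputable def symmetrizedGen (n : ℕ) (kp km : ZMod n → ℝ) : Matrix (ZMod n) (ZMod n) ℂ :=
  periodicJacobi n (fun i => -((kp i : ℂ) + km i)) (fun i => -(√(kp i * km (i + 1)) : ℝ))
    (fun i => -(√(kp (i - 1) * km i) : ℝ))

section Symmetrized

variable {n : ℕ} {kp km : ZMod n → ℝ}

lemma smul_one_sub_symmetrizedGen (hn : 3 ≤ n) (kp km : ZMod n → ℝ) (x : ℂ) :
    x • (1 : Matrix (ZMod n) (ZMod n) ℂ) - symmetrizedGen n kp km =
      periodicJacobi n (fun i => x + ((kp i : ℂ) + km i)) (fun i => (√(kp i * km (i + 1)) : ℝ))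
        (fun i => (√(kp (i - 1) * km (i - 1 + 1)) : ℝ)) := by
  ext i j
  have : Fact (1 < n) := ⟨by omega⟩
  have e1 := periodicJacobi.sub_one_ne_self hn i
  have e2 := periodicJacobi.add_one_ne_sub_one hn i
  simp only [Matrix.sub_apply, Matrix.smul_apply, Matrix.one_apply, symmetrizedGen,
    periodicJacobi, Matrix.of_apply, sub_add_cancel, smul_eq_mul]
  by_cases h1 : j = i + 1
  · simp [h1]
  · by_cases h2 : j = i - 1
    · simp [h2, e1.symm, e2.symm]
    · by_cases h3 : j = i
      · simp [h3, e1.symm]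
        ring
      · simp [h1, h2, h3, Ne.symm h3]

lemma prod_sqrt_mul [NeZero n] (hkp : ∀ i, 0 ≤ kp i) :
    ∏ i, √(kp i * km (i + 1)) = (∏ i, √(kp i)) * ∏ i, √(km i) := by
  rw [← Equiv.prod_comp (Equiv.addRight (1 : ZMod n)) fun i => √(km i), ← Finset.prod_mul_distrib]
  exact Finset.prod_congr rfl fun i _ => Real.sqrt_mul (hkp i) _

lemma prod_eq_sq_prod_sqrt [NeZero n] (hkp : ∀ i, 0 ≤ kp i) : ∏ i, kp i = (∏ i, √(kp i)) ^ 2 := by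
  rw [← Finset.prod_pow]
  exact Finset.prod_congr rfl fun i _ => (Real.sq_sqrt (hkp i)).symm

/-- If consecutive ratios of an eigenvector lie in the upper half plane, their arguments add up
to the angle sum of the eigenvalue with respect to the symmetrized spectrum. -/
theorem sum_arg_ratio_eq_angleSum [NeZero n] (hn : 3 ≤ n) (hkp : ∀ i, 0 < kp i)
    (hkm : ∀ i, 0 ≤ km i) (hlt : ∏ i, km i < ∏ i, kp i) {r : ZMod n → ℝ}
    (hr : (symmetrizedGen n kp km).charpoly.roots = Finset.univ.val.map fun i => (r i : ℂ))
    {l : ℂ} (hl : 0 < l.im) {u : ZMod n → ℂ}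
    (hu : ∀ i, kp i * u (i + 1) + km i * u (i - 1) = (l + (kp i + km i)) * u i)
    (hz : ∀ i, 0 < (u (i + 1) / u i).im) :
    ∑ i, Complex.arg (u (i + 1) / u i) = angleSum r l := by
  have hu0 : ∀ i, u i ≠ 0 := fun i h => by simpa [h] using hz i
  set a : unitInterval → ZMod n → ℂ := fun t i =>
    kp i * (u (i + 1) / u i) + ((t : ℝ) : ℂ) ^ 2 * (km i * (u (i - 1) / u i)) with ha
  have ha1 : ∀ i, a 1 i = l + (kp i + km i) := by
    intro i
    simp only [ha, Set.Icc.coe_one, Complex.ofReal_one]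
    field_simp [hu0 i]
    linear_combination hu i
  have hpos : ∀ i, 0 < (kp i * (u (i + 1) / u i)).im := fun i => by
    rw [Complex.im_ofReal_mul]
    exact mul_pos (hkp i) (hz i)
  have ha_im : ∀ t i, 0 < (a t i).im := by
    intro t i
    have h1 := hpos i
    have h2 : 0 < (a 1 i).im := by rw [ha1]; simpa using hl
    have ht0 := t.2.1
    have ht1 : (t : ℝ) ^ 2 ≤ 1 := pow_le_one₀ ht0 t.2.2
    simp only [ha, Set.Icc.coe_one, Complex.ofReal_one, one_pow, one_mul, Complex.add_im,
      ← Complex.ofReal_pow, Complex.im_ofReal_mul] at h1 h2 ⊢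
    nlinarith [mul_nonneg (sq_nonneg (t : ℝ)) h2.le,
      mul_nonneg (sub_nonneg.2 ht1) h1.le, sq_nonneg (t : ℝ)]
  set s : ZMod n → ℝ := fun i => √(kp i * km (i + 1)) with hs
  set W : unitInterval → Matrix (ZMod n) (ZMod n) ℂ := fun t =>
    -Complex.I • periodicJacobi n (a t) (fun i => ((t * s i : ℝ) : ℂ))
      (fun i => ((t * s (i - 1) : ℝ) : ℂ)) with hW
  set A := ∏ i, √(kp i) with hA
  set B := ∏ i, √(km i) with hB
  have hA0 : 0 ≤ A := Finset.prod_nonneg fun i _ => Real.sqrt_nonneg _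
  have hB0 : 0 ≤ B := Finset.prod_nonneg fun i _ => Real.sqrt_nonneg _
  have hAB : B < A := by
    rw [prod_eq_sq_prod_sqrt hkm, prod_eq_sq_prod_sqrt fun i => (hkp i).le] at hlt
    exact lt_of_pow_lt_pow_left₀ 2 hA0 hlt
  have hcont : Continuous W := by
    refine continuous_matrix fun i j => ?_
    simp only [hW, ha, periodicJacobi, Matrix.smul_apply, Matrix.of_apply]
    split_ifs <;> fun_prop
  have hdet : ∀ t, ∃ x : ℝ, 0 < x ∧ (W t).det = x * (-Complex.I) ^ n := by
    intro t
    have ht1 : (t : ℝ) ^ n ≤ 1 := pow_le_one₀ t.2.1 t.2.2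
    refine ⟨(A - t ^ n * B) ^ 2, pow_pos (by nlinarith) 2, ?_⟩
    have h := periodicJacobi.det_add_prod_eq hn (a t) (fun i => ((t * s i : ℝ) : ℂ))
      (fun i => ((t * s (i - 1) : ℝ) : ℂ)) (fun i => kp i)
      (fun i => ((t : ℝ) : ℂ) ^ 2 * km i) (fun i => by
        have := Real.mul_self_sqrt (mul_nonneg (hkp i).le (hkm (i + 1)))
        simp only [add_sub_cancel_right, hs]
        have := congrArg Complex.ofReal this
        push_cast at this ⊢
        linear_combination ((t : ℝ) : ℂ) ^ 2 * this)
    have hker : (periodicJacobi n (a t) (fun i => kp i)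
        (fun i => ((t : ℝ) : ℂ) ^ 2 * km i)).det = 0 := by
      refine exists_mulVec_eq_zero_iff.1 ⟨u, fun h => hu0 0 (congrFun h 0), ?_⟩
      ext i
      rw [periodicJacobi.mulVec_apply hn]
      simp only [ha, Pi.zero_apply]
      field_simp [hu0 i]
      ring
    have hs1 : ∏ i, s (i - 1) = A * B := by
      refine (Equiv.prod_comp (Equiv.subRight (1 : ZMod n)) s).trans ?_
      exact prod_sqrt_mul fun i => (hkp i).le
    have hs0 : ∏ i, s i = A * B := prod_sqrt_mul fun i => (hkp i).le
    rw [hker] at h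
    simp only [← Complex.ofReal_prod, ← Complex.ofReal_pow, ← Complex.ofReal_mul,
      Finset.prod_mul_distrib, Finset.prod_const, Finset.card_univ, ZMod.card, hs1, hs0,
      prod_eq_sq_prod_sqrt hkm, prod_eq_sq_prod_sqrt fun i => (hkp i).le, ← hA, ← hB] at h
    rw [hW, det_smul, ZMod.card, mul_comm]
    congr 1
    push_cast at h ⊢
    linear_combination h
  have key := sum_arg_roots_eq hcont (fun t w hw => by
    refine periodicJacobi.re_pos_of_mem_roots hn (ha_im t) (fun i => t * s i) hw) hdet 0 1
  have hW0 : (W 0).charpoly.roots =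
      Finset.univ.val.map fun i => -Complex.I * (kp i * (u (i + 1) / u i)) := by
    have : W 0 = Matrix.diagonal fun i => -Complex.I * (kp i * (u (i + 1) / u i)) := by
      have h0 : (fun _ => 0 : ZMod n → ℂ) = 0 := rfl
      simp only [hW, ha, Set.Icc.coe_zero, zero_mul, Complex.ofReal_zero, h0,
        periodicJacobi.zero_offDiag hn, ← Matrix.diagonal_smul]
      congr 1
      ext i
      simp
    rw [this, roots_charpoly_diagonal]
  have hW1 : (W 1).charpoly.roots =
      Finset.univ.val.map fun i => -Complex.I * (l - r i) := by
    have : W 1 = (-Complex.I * l) • (1 : Matrix (ZMod n) (ZMod n) ℂ) +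
        Complex.I • symmetrizedGen n kp km := by
      have h := smul_one_sub_symmetrizedGen hn kp km l
      simp only [hW, Set.Icc.coe_one, one_mul, hs]
      rw [show a 1 = fun i => l + (kp i + km i) from funext ha1, ← h, smul_sub, smul_smul,
        neg_smul _ (symmetrizedGen n kp km), sub_neg_eq_add]
    rw [this, roots_charpoly_smul_one_add_smul, hr, Multiset.map_map]
    refine Multiset.map_congr rfl fun i _ => ?_
    simp only [Function.comp]
    ring
  rw [hW0, hW1, Multiset.map_map, Multiset.map_map] at key
  have e0 : ∀ i, Complex.arg (-Complex.I * (kp i * (u (i + 1) / u i))) =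
      Complex.arg (u (i + 1) / u i) - Real.pi / 2 := fun i => by
    have := hpos i
    rw [arg_neg_I_mul this.le fun h => by simp [h] at this, Complex.arg_real_mul _ (hkp i)]
  have e1 : ∀ i, Complex.arg (-Complex.I * (l - r i)) = Complex.arg (l - r i) - Real.pi / 2 :=
    fun i => by
      have : 0 < (l - r i).im := by simpa using hl
      rw [arg_neg_I_mul this.le fun h => by simp [h] at this]
  change ∑ i, Complex.arg (-Complex.I * (kp i * (u (i + 1) / u i))) =
    ∑ i, Complex.arg (-Complex.I * (l - r i)) at key
  rw [angleSum_of_im_nonneg hl.le]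
  simpa only [e0, e1, Finset.sum_sub_distrib, sub_left_inj] using key

lemma roots_charpoly_symmetrizedGen_neg [NeZero n] (hn : 3 ≤ n) (kp km : ZMod n → ℝ) :
    (symmetrizedGen n (fun i => km (-i)) fun i => kp (-i)).charpoly.roots =
      (symmetrizedGen n kp km).charpoly.roots := by
  rw [← charpoly_reindex (Equiv.neg (ZMod n)) (symmetrizedGen n kp km)]
  congr 2
  ext i j
  have e1 : -j = -i + 1 ↔ j = i - 1 := by
    constructor <;> intro h <;> linear_combination -h
  have e2 : -j = -i - 1 ↔ j = i + 1 := by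
    constructor <;> intro h <;> linear_combination -h
  have e3 := periodicJacobi.add_one_ne_sub_one hn i
  simp only [symmetrizedGen, periodicJacobi, Matrix.of_apply, Matrix.reindex_apply,
    Matrix.submatrix_apply, Equiv.neg_symm, Equiv.neg_apply, e1, e2, neg_inj]
  by_cases h1 : j = i + 1
  · simp only [h1, e3, if_true, if_false, mul_comm (km (-i))]
    rw [neg_add']
  · by_cases h2 : j = i - 1
    · simp only [h2, e3.symm, if_true, if_false, neg_sub, mul_comm (km _)]
      rw [neg_add_eq_sub]
    · simp only [h1, h2, if_false, add_comm]

/-- Sign dichotomy for the currents `J` of a cyclic balance equation with sources `q`. -/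
lemma current_dichotomy [NeZero n] (hkp : ∀ i, 0 < kp i) (hkm : ∀ i, 0 ≤ km i) {J q : ZMod n → ℝ}
    (h : ∀ i, kp i * J i - km i * J (i - 1) = q i) (hq : ∀ i, 0 ≤ q i)
    (hJ : ∀ i, J i ≠ 0 → q i ≠ 0) (hJ' : ∀ i, J (i - 1) ≠ 0 → q i ≠ 0) (hne : ∃ i, q i ≠ 0) :
    (∀ i, 0 < J i) ∧ ∏ i, km i < ∏ i, kp i ∨
      (∀ i, J i < 0) ∧ (∀ i, 0 < km i) ∧ ∏ i, kp i < ∏ i, km i := by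
  have hshift : ∀ f : ZMod n → ℝ, ∏ i, f (i - 1) = ∏ i, f i := fun f =>
    Equiv.prod_comp (Equiv.subRight (1 : ZMod n)) f
  have back : ∀ p : ZMod n → Prop, (∃ i, p i) → (∀ i, p i → p (i - 1)) → ∀ i, p i := by
    rintro p ⟨i, hi⟩ hp j
    have := periodicJacobi.forall_of_add_one (p := fun j => p (-j)) (-i) (by simpa using hi)
      (fun j hj => by rw [neg_add']; exact hp _ hj) (-j)
    simpa using this
  by_cases hneg : ∃ i, J i < 0
  · right
    have step : ∀ i, J i < 0 → J (i - 1) < 0 ∧ 0 < km i := by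
      intro i hi
      have h1 : 0 < km i * -J (i - 1) := by nlinarith [h i, hq i, mul_pos (hkp i) (neg_pos.2 hi)]
      have h2 : 0 < km i := lt_of_le_of_ne (hkm i) fun h0 => by simp [← h0] at h1
      exact ⟨neg_pos.1 (pos_of_mul_pos_right h1 h2.le), h2⟩
    have hall := back (fun i => J i < 0) hneg fun i hi => (step i hi).1
    refine ⟨hall, fun i => (step i (hall i)).2, ?_⟩
    have hlt : ∏ i, kp i * -J i < ∏ i, km i * -J (i - 1) :=
      Finset.prod_lt_prod_of_nonempty (fun i _ => mul_pos (hkp i) (neg_pos.2 (hall i)))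
        (fun i _ => by
          have := lt_of_le_of_ne (hq i) (hJ i (hall i).ne).symm
          linarith [h i]) Finset.univ_nonempty
    rw [Finset.prod_mul_distrib, Finset.prod_mul_distrib, hshift fun i => -J i] at hlt
    exact lt_of_mul_lt_mul_right hlt (Finset.prod_nonneg fun i _ => (neg_pos.2 (hall i)).le)
  · left
    push Not at hneg
    have hpos : ∀ i, 0 < J i := by
      by_contra! h0
      obtain ⟨i, hi⟩ := hne
      have hq0 : ∀ i, J i ≤ 0 → q i = 0 := fun i hi => le_antisymm
        (by nlinarith [h i, mul_nonneg (hkm i) (hneg (i - 1)), hkp i]) (hq i)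
      exact hi (hq0 i (back (fun i => J i ≤ 0) h0
        (fun i hi => (not_not.1 (mt (hJ' i) (not_not.2 (hq0 i hi)))).le) i))
    refine ⟨hpos, ?_⟩
    rcases eq_or_ne (∏ i, km i) 0 with h0 | h0
    · rw [h0]
      exact Finset.prod_pos fun i _ => hkp i
    · have hkm' : ∀ i, 0 < km i := fun i =>
        lt_of_le_of_ne (hkm i) (Finset.prod_ne_zero_iff.1 h0 i (Finset.mem_univ i)).symm
      have hlt : ∏ i, km i * J (i - 1) < ∏ i, kp i * J i :=
        Finset.prod_lt_prod_of_nonempty (fun i _ => mul_pos (hkm' i) (hpos _))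
          (fun i _ => by
            have := lt_of_le_of_ne (hq i) (hJ i (hpos i).ne').symm
            linarith [h i]) Finset.univ_nonempty
      rw [Finset.prod_mul_distrib, Finset.prod_mul_distrib, hshift J] at hlt
      exact lt_of_mul_lt_mul_right hlt (Finset.prod_nonneg fun i _ => (hpos i).le)

lemma im_div_eq (z w : ℂ) : (z / w).im = (conj w * z).im / Complex.normSq w := by
  rw [Complex.div_im, Complex.mul_im, Complex.conj_re, Complex.conj_im]
  ring

lemma sum_arg_conj_ratio [NeZero n] {u : ZMod n → ℂ} (h : ∀ i, (u (i + 1) / u i).im ≠ 0) :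
    ∑ i, Complex.arg (conj (u (i + 1)) / conj (u i)) = -∑ i, Complex.arg (u (i + 1) / u i) := by
  rw [← Finset.sum_neg_distrib]
  refine Finset.sum_congr rfl fun i _ => ?_
  rw [← map_div₀, Complex.arg_conj, if_neg]
  exact fun hpi => h i (Complex.arg_eq_pi_iff.1 hpi).2

/-- The components of an eigenvector with nonreal eigenvalue do not vanish, and its winding is
the angle sum of the eigenvalue with respect to the symmetrized spectrum. -/
theorem abs_sum_arg_ratio_eq_angleSum [NeZero n] (hn : 3 ≤ n) (hkp : ∀ i, 0 < kp i)
    (hkm : ∀ i, 0 ≤ km i) {r : ZMod n → ℝ}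
    (hr : (symmetrizedGen n kp km).charpoly.roots = Finset.univ.val.map fun i => (r i : ℂ))
    {l : ℂ} (hl : l.im ≠ 0) {u : ZMod n → ℂ} (hu0 : u ≠ 0)
    (hu : ∀ i, kp i * u (i + 1) + km i * u (i - 1) = (l + (kp i + km i)) * u i) :
    (∀ i, (u (i + 1) / u i).im ≠ 0) ∧ |∑ i, Complex.arg (u (i + 1) / u i)| = angleSum r l ∧
      ∏ i, kp i ≠ ∏ i, km i := by
  wlog him : 0 < l.im generalizing l u
  · obtain ⟨h1, h2, h3⟩ := this (l := conj l) (u := fun i => conj (u i)) (by simpa using hl)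
      (fun h => hu0 (funext fun i => by simpa using congrFun h i))
      (fun i => by simpa using congrArg conj (hu i))
      (by simpa using lt_of_le_of_ne (not_lt.1 him) hl)
    have h1' : ∀ i, (u (i + 1) / u i).im ≠ 0 := fun i hi => h1 i (by simp [← map_div₀, hi])
    rw [sum_arg_conj_ratio h1', abs_neg, angleSum_conj] at h2
    exact ⟨h1', h2, h3⟩
  have hnorm : ∀ i, l.im * Complex.normSq (u i) ≠ 0 ↔ u i ≠ 0 := fun i => by
    simp [him.ne']
  have hJ : ∀ i, kp i * (conj (u i) * u (i + 1)).im -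
      km i * (conj (u (i - 1)) * u (i - 1 + 1)).im = l.im * Complex.normSq (u i) := by
    intro i
    have := congrArg Complex.im (congrArg (conj (u i) * ·) (hu i))
    rw [sub_add_cancel]
    simp [Complex.normSq_apply] at this ⊢
    linarith
  have hdich := current_dichotomy (J := fun i => (conj (u i) * u (i + 1)).im) hkp hkm hJ
    (fun i => mul_nonneg him.le (Complex.normSq_nonneg _))
    (fun i h => (hnorm i).2 fun h' => h (by simp [h']))
    (fun i h => (hnorm i).2 fun h' => h (by simp [h']))
    ((Function.ne_iff.1 hu0).imp fun i hi => (hnorm i).2 hi)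
  have hsq : (∀ i, (conj (u i) * u (i + 1)).im ≠ 0) → ∀ i, 0 < Complex.normSq (u i) :=
    fun h i => Complex.normSq_pos.2 fun h' => h i (by simp [h'])
  rcases hdich with ⟨hpos, hlt⟩ | ⟨hneg, hkm', hlt⟩
  · have hz : ∀ i, 0 < (u (i + 1) / u i).im := fun i => by
      rw [im_div_eq]
      exact div_pos (hpos i) (hsq (fun i => (hpos i).ne') i)
    refine ⟨fun i => (hz i).ne', ?_, hlt.ne'⟩
    rw [sum_arg_ratio_eq_angleSum hn hkp hkm hlt hr him hu hz, abs_of_nonneg angleSum_nonneg]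
  · have hz : ∀ i, (u (i + 1) / u i).im < 0 := fun i => by
      rw [im_div_eq]
      exact div_neg_of_neg_of_pos (hneg i) (hsq (fun i => (hneg i).ne) i)
    refine ⟨fun i => (hz i).ne, ?_, hlt.ne⟩
    have hz' : ∀ i, 0 < (u (i - 1) / u i).im := fun i => by
      have := hz (i - 1)
      rw [sub_add_cancel, ← inv_div, Complex.inv_im] at this
      by_contra! h
      exact absurd this (not_lt.2 (div_nonneg (neg_nonneg.2 h) (Complex.normSq_nonneg _)))
    have hprod : ∀ f : ZMod n → ℝ, ∏ i, f (-i) = ∏ i, f i := fun f =>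
      Equiv.prod_comp (Equiv.neg (ZMod n)) f
    have key := sum_arg_ratio_eq_angleSum (u := fun i => u (-i)) hn (fun i => hkm' (-i))
      (fun i => (hkp (-i)).le) (by rw [hprod, hprod]; exact hlt)
      ((roots_charpoly_symmetrizedGen_neg hn kp km).trans hr) him
      (fun i => by
        have := hu (-i)
        rw [neg_add', neg_sub', sub_neg_eq_add]
        linear_combination this)
      (fun i => by
        rw [neg_add']
        exact hz' (-i))
    have hsum : ∑ i, Complex.arg (u (-(i + 1)) / u (-i)) =
        -∑ i, Complex.arg (u (i + 1) / u i) := by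
      rw [← Finset.sum_neg_distrib, ← Equiv.sum_comp ((Equiv.neg (ZMod n)).trans
        (Equiv.subRight 1)) fun i => -Complex.arg (u (i + 1) / u i)]
      refine Finset.sum_congr rfl fun i _ => ?_
      have hne : Complex.arg (u (-i) / u (-i - 1)) ≠ Real.pi := fun h => by
        have := hz (-i - 1)
        rw [sub_add_cancel] at this
        exact this.ne (Complex.arg_eq_pi_iff.1 h).2
      simp only [Equiv.trans_apply, Equiv.neg_apply, Equiv.subRight_apply, sub_add_cancel]
      rw [neg_add', ← inv_div, Complex.arg_inv, if_neg hne]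
    rw [hsum] at key
    rw [← abs_neg, key, abs_of_nonneg angleSum_nonneg]

end Symmetrized

section Generator

variable {n : ℕ} {kp km : ZMod n → ℝ}

lemma isHermitian_symmetrizedGen (hn : 3 ≤ n) (kp km : ZMod n → ℝ) :
    (symmetrizedGen n kp km).IsHermitian := by
  ext i j
  have e1 : i = j + 1 ↔ j = i - 1 := by
    constructor <;> intro h <;> linear_combination -h
  have e2 : i = j - 1 ↔ j = i + 1 := by
    constructor <;> intro h <;> linear_combination -h
  have e3 := periodicJacobi.add_one_ne_sub_one hn i
  have e4 := (periodicJacobi.sub_one_ne_self hn i).symm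
  have : Fact (1 < n) := ⟨by omega⟩
  simp only [symmetrizedGen, periodicJacobi, Matrix.of_apply, Matrix.conjTranspose_apply, e1, e2]
  by_cases h1 : j = i + 1
  · simp [h1, e3]
  · by_cases h2 : j = i - 1
    · simp [h2, e3.symm]
    · by_cases h3 : j = i
      · simp [h3, e4]
      · simp [h1, h2, h3, Ne.symm h3]

lemma smul_one_sub_uniGenC_transpose [NeZero n] (hn : 3 ≤ n) (kp km : ZMod n → ℝ) (x : ℂ) :
    x • (1 : Matrix (ZMod n) (ZMod n) ℂ) - (uniGenC n kp km)ᵀ =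
      periodicJacobi n (fun i => x + ((kp i : ℂ) + km i)) (fun i => kp i) (fun i => km i) := by
  ext i j
  have e0 := periodicJacobi.add_one_ne_self hn i
  have e1 := periodicJacobi.sub_one_ne_self hn i
  have e2 := periodicJacobi.add_one_ne_sub_one hn i
  simp only [Matrix.sub_apply, Matrix.smul_apply, Matrix.one_apply, uniGenC,
    periodicJacobi, Matrix.of_apply, Matrix.transpose_apply, smul_eq_mul]
  by_cases h1 : j = i + 1
  · simp [h1, e0.symm]
  · by_cases h2 : j = i - 1
    · simp [h2, e1.symm, e2.symm]
    · by_cases h3 : j = i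
      · simp [h3, e0.symm, e1.symm]
        ring
      · simp [h1, h2, h3, Ne.symm h3]

lemma eval_charpoly_eq_prod {ι κ : Type*} [Fintype ι] [DecidableEq ι] [Fintype κ]
    {M : Matrix ι ι ℂ} {f : κ → ℂ} (h : M.charpoly.roots = Finset.univ.val.map f) (x : ℂ) :
    (x • (1 : Matrix ι ι ℂ) - M).det = ∏ k, (x - f k) := by
  rw [smul_one_eq_diagonal, ← scalar_apply, ← eval_charpoly,
    (IsAlgClosed.splits _).eval_eq_prod_roots_of_monic (charpoly_monic M), h, Multiset.map_map]
  rfl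

lemma prod_sub_eigenvalues [NeZero n] (hn : 3 ≤ n) (hkp : ∀ i, 0 ≤ kp i) (hkm : ∀ i, 0 ≤ km i)
    {lam : Fin n → ℂ} (hlam : (uniGenC n kp km).charpoly.roots = Finset.univ.val.map lam)
    {r : ZMod n → ℝ}
    (hr : (symmetrizedGen n kp km).charpoly.roots = Finset.univ.val.map fun i => (r i : ℂ))
    (z : ℂ) :
    ∏ j, (z - lam j) = ∏ i, (z - r i) - ((∏ i, √(kp i) - ∏ i, √(km i)) ^ 2 : ℝ) := by
  rw [← charpoly_transpose] at hlam
  rw [← eval_charpoly_eq_prod hlam, ← eval_charpoly_eq_prod hr,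
    smul_one_sub_uniGenC_transpose hn, smul_one_sub_symmetrizedGen hn]
  have h := periodicJacobi.det_add_prod_eq hn (fun i => z + ((kp i : ℂ) + km i)) (fun i => kp i)
    (fun i => km i) (fun i => (√(kp i * km (i + 1)) : ℝ))
    (fun i => (√(kp (i - 1) * km (i - 1 + 1)) : ℝ)) (fun i => by
      have := Real.mul_self_sqrt (mul_nonneg (hkp i) (hkm (i + 1)))
      simp only [add_sub_cancel_right]
      exact_mod_cast this.symm)
  have hs : ∏ i, √(kp (i - 1) * km (i - 1 + 1)) = (∏ i, √(kp i)) * ∏ i, √(km i) :=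
    (Equiv.prod_comp (Equiv.subRight (1 : ZMod n)) fun i => √(kp i * km (i + 1))).trans
      (prod_sqrt_mul hkp)
  simp only [← Complex.ofReal_prod, hs, prod_sqrt_mul hkp, prod_eq_sq_prod_sqrt hkm,
    prod_eq_sq_prod_sqrt hkp] at h
  push_cast at h ⊢
  linear_combination h

lemma wrapIdx_of_abs_eq {m : ℤ} {w : ℤ} (hw : |w| = m) (hm : 0 < m) (hmn : 2 * m < n) :
    wrapIdx n w = m := by
  unfold wrapIdx
  rcases (abs_eq hm.le).1 hw with rfl | rfl
  · rw [Int.emod_eq_of_lt hm.le (by omega), Int.emod_eq_of_lt (by omega) (by omega)]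
    omega
  · rw [sub_neg_eq_add, Int.add_emod_left, Int.emod_eq_of_lt hm.le (by omega),
      ← Int.add_emod_right, Int.emod_eq_of_lt (by omega) (by omega)]
    omega

end Generator

theorem unicyclic_ordered_winding
    (n : ℕ) [NeZero n] (hn : 3 ≤ n)
    (kp km : ZMod n → ℝ) (hkp : ∀ i, 0 < kp i) (hkm : ∀ i, 0 ≤ km i)
    (lam : Fin n → ℂ)
    (hroots : (uniGenC n kp km).charpoly.roots = Multiset.map lam Finset.univ.val)
    (hsort : ∀ i j : Fin n, i ≤ j → (lam j).re ≤ (lam i).re)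
    (k : Fin n) (hk : (lam k).im ≠ 0)
    (u : ZMod n → ℂ) (hu : u ≠ 0)
    (heig : (uniGenC n kp km)ᵀ *ᵥ u = lam k • u) :
    (∀ i, u i ≠ 0) ∧ windingNum n u = (((k : ℕ) + 1) / 2 : ℕ) := by
  have hpi := Real.pi_pos
  have hr := (isHermitian_symmetrizedGen hn kp km).roots_charpoly_eq_eigenvalues
  set r := (isHermitian_symmetrizedGen hn kp km).eigenvalues
  have hr' : (symmetrizedGen n kp km).charpoly.roots = Finset.univ.val.map fun i => (r i : ℂ) := hr
  have hbal : ∀ i, kp i * u (i + 1) + km i * u (i - 1) = (lam k + (kp i + km i)) * u i := by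
    intro i
    have h : (lam k • (1 : Matrix (ZMod n) (ZMod n) ℂ) - (uniGenC n kp km)ᵀ) *ᵥ u = 0 := by
      rw [sub_mulVec, heig, smul_mulVec, one_mulVec, sub_self]
    rw [smul_one_sub_uniGenC_transpose hn] at h
    have := congrFun h i
    rw [periodicJacobi.mulVec_apply hn, Pi.zero_apply] at this
    linear_combination -this
  obtain ⟨hne, habs, hprod⟩ := abs_sum_arg_ratio_eq_angleSum hn hkp hkm hr' hk hu hbal
  refine ⟨fun i h => hne i (by simp [h]), ?_⟩
  have hc : 0 < (∏ i, √(kp i) - ∏ i, √(km i)) ^ 2 := sq_pos_of_ne_zero fun h => hprod <| by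
    rw [prod_eq_sq_prod_sqrt fun i => (hkp i).le, prod_eq_sq_prod_sqrt hkm, sub_eq_zero.1 h]
  obtain ⟨hang, hm, hmn⟩ := index_eq_of_angleSum (ZMod.card n) hc
    (prod_sub_eigenvalues hn (fun i => (hkp i).le) hkm hroots hr') hsort k hk
  set m := ((k : ℕ) + 1) / 2
  rw [hang] at habs
  refine wrapIdx_of_abs_eq ?_ (by exact_mod_cast hm) (by exact_mod_cast hmn)
  rcases (abs_eq (by positivity)).1 habs with h | h
  · rw [h, mul_div_cancel_left₀ _ (by positivity)]
    simp
  · rw [h, neg_div, mul_div_cancel_left₀ _ (by positivity), ← Int.cast_natCast, ← Int.cast_neg,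
      round_intCast]
    simp
end

section
/- Let R be the unicyclic generator on n ≥ 3 states with rates k⁺ᵢ > 0, k⁻ᵢ ≥ 0. If λ₁, λ₂, …, λₙ is any listing of the eigenvalues of R (roots of the characteristic polynomial with multiplicity) with Re λ₁ ≥ Re λ₂ ≥ ⋯ ≥ Re λₙ, then λ₁ = 0 and the real parts pair up with strict separations between consecutive pairs: Re λ_{2m−1} > Re λ_{2m} for every m with 2m ≤ n, i.e. 0 = λ₁ > Re λ₂ ≥ Re λ₃ > Re λ₄ ≥ Re λ₅ > ⋯. -/
open Matrix Finset

lemma ZMod.one_ne_zero_of_three_le {n : ℕ} (hn : 3 ≤ n) : (1 : ZMod n) ≠ 0 := by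
  have : Fact (1 < n) := ⟨by omega⟩
  exact one_ne_zero

lemma ZMod.two_ne_zero_of_three_le {n : ℕ} (hn : 3 ≤ n) : (1 + 1 : ZMod n) ≠ 0 := by
  intro h
  have h2 : ((2 : ℕ) : ZMod n) = 0 := by push_cast; rw [← h]; norm_num
  rw [ZMod.natCast_eq_zero_iff] at h2
  have := Nat.le_of_dvd (by norm_num) h2
  omega

lemma perm_eq_addRight_one {n : ℕ} [NeZero n] (hn : 3 ≤ n) (σ : Equiv.Perm (ZMod n))
    (hσ : ∀ i, σ i = i + 1 ∨ σ i = i - 1 ∨ σ i = i) (i₀ : ZMod n)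
    (h₁ : σ i₀ = i₀ + 1) (h₂ : σ (i₀ + 1) ≠ i₀) : σ = Equiv.addRight 1 := by
  have one0 := ZMod.one_ne_zero_of_three_le hn
  have two0 := ZMod.two_ne_zero_of_three_le hn
  have key : ∀ k : ℕ, σ (i₀ + k) = i₀ + k + 1 ∧ σ (i₀ + k + 1) = i₀ + k + 1 + 1 := by
    intro k
    induction k with
    | zero =>
      simp only [Nat.cast_zero, add_zero]
      refine ⟨h₁, ?_⟩
      rcases hσ (i₀ + 1) with h | h | h
      · exact h
      · exact absurd (by simpa using h) h₂
      · exact absurd (σ.injective (h.trans h₁.symm)) (by simpa using one0)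
    | succ k ih =>
      obtain ⟨ih1, ih2⟩ := ih
      push_cast
      rw [← add_assoc]
      refine ⟨ih2, ?_⟩
      rcases hσ (i₀ + k + 1 + 1) with h | h | h
      · exact h
      · have h := σ.injective ((h.trans (add_sub_cancel_right _ _)).trans ih1.symm)
        rw [add_assoc (i₀ + (k : ZMod n)), add_eq_left] at h
        exact absurd h two0
      · exact absurd (σ.injective (h.trans ih2.symm)) (by simpa using one0)
  ext1 i
  have := (key (i - i₀).val).1
  rw [ZMod.natCast_zmod_val] at this
  simpa using this

lemma apply_add_one_eq_iff {n : ℕ} [NeZero n] (hn : 3 ≤ n) (σ : Equiv.Perm (ZMod n))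
    (hσ : ∀ i, σ i = i + 1 ∨ σ i = i - 1 ∨ σ i = i)
    (h₁ : σ ≠ Equiv.addRight 1) (h₂ : σ ≠ (Equiv.addRight 1)⁻¹) (i : ZMod n) :
    σ (i + 1) = i ↔ σ i = i + 1 := by
  constructor
  · intro h
    by_contra h'
    refine h₂ (inv_eq_iff_eq_inv.mp (perm_eq_addRight_one hn σ⁻¹ (fun j => ?_) i ?_ ?_))
    · have hj : σ (σ⁻¹ j) = j := σ.apply_symm_apply j
      rcases hσ (σ⁻¹ j) with h | h | h <;> rw [hj] at h
      · exact .inr (.inl (eq_sub_of_add_eq h.symm))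
      · exact .inl (sub_eq_iff_eq_add.mp h.symm)
      · exact .inr (.inr h.symm)
    · rw [Equiv.Perm.inv_eq_iff_eq, h]
    · rw [Ne, Equiv.Perm.inv_eq_iff_eq]
      exact fun h => h' h.symm
  · intro h
    by_contra h'
    exact h₁ (perm_eq_addRight_one hn σ hσ i h h')

lemma sign_addRight_one (n : ℕ) [NeZero n] :
    Equiv.Perm.sign (Equiv.addRight (1 : ZMod n)) = -(-1) ^ n := by
  cases n with
  | zero => exact absurd rfl (NeZero.ne 0)
  | succ n =>
    have : (Equiv.addRight (1 : ZMod (n + 1)) : Equiv.Perm (ZMod (n + 1))) = finRotate (n + 1) := by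
      ext1 i
      exact (finRotate_apply i).symm
    rw [this]
    exact (sign_finRotate (n + 1)).trans (by simp [pow_succ])

/-- A matrix indexed by the cycle `ℤ/nℤ` whose nonzero entries couple only neighbours. -/
def IsCyclicTridiagonal {n : ℕ} {A : Type*} [Zero A] (M : Matrix (ZMod n) (ZMod n) A) : Prop :=
  ∀ j i, j ≠ i + 1 → j ≠ i - 1 → j ≠ i → M j i = 0

lemma prod_perm_eq_of_adjacent {n : ℕ} [NeZero n] (hn : 3 ≤ n) {A : Type*} [CommRing A]
    {M : Matrix (ZMod n) (ZMod n) A}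
    (σ : Equiv.Perm (ZMod n)) (hσ : ∀ i, σ i = i + 1 ∨ σ i = i - 1 ∨ σ i = i)
    (h₁ : σ ≠ Equiv.addRight 1) (h₂ : σ ≠ (Equiv.addRight 1)⁻¹) :
    ∏ i, M (σ i) i =
      (∏ i, if σ i = i then M i i else 1) *
        ∏ i, if σ i = i + 1 then M (i + 1) i * M i (i + 1) else 1 := by
  have one0 := ZMod.one_ne_zero_of_three_le hn
  have two0 := ZMod.two_ne_zero_of_three_le hn
  have h3 : (∏ i, if σ i = i - 1 then M (i - 1) i else 1) =
      ∏ i, if σ i = i + 1 then M i (i + 1) else 1 := by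
    rw [← Equiv.prod_comp (Equiv.addRight (1 : ZMod n))]
    refine prod_congr rfl fun i _ => ?_
    simp only [Equiv.coe_addRight, add_sub_cancel_right, apply_add_one_eq_iff hn σ hσ h₁ h₂]
  have h4 : ∀ i, (if σ i = i + 1 then M (i + 1) i * M i (i + 1) else 1) =
      (if σ i = i + 1 then M (i + 1) i else 1) * (if σ i = i + 1 then M i (i + 1) else 1) := by
    intro i; split_ifs <;> simp
  simp_rw [h4]
  rw [prod_mul_distrib, ← h3, ← prod_mul_distrib, ← prod_mul_distrib]
  refine prod_congr rfl fun i _ => ?_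
  have e1 : i + 1 ≠ i := by simpa using one0
  have e2 : i - 1 ≠ i := by simpa using one0
  have e3 : i + 1 ≠ i - 1 := by
    intro h
    rw [eq_sub_iff_add_eq, add_assoc, add_eq_left] at h
    exact two0 h
  rcases hσ i with h | h | h <;> simp [h, e1, e2, e3, e1.symm, e2.symm, e3.symm]

lemma IsCyclicTridiagonal.det_sub_eq {n : ℕ} [NeZero n] (hn : 3 ≤ n) {A : Type*} [CommRing A]
    {M N : Matrix (ZMod n) (ZMod n) A} (hM : IsCyclicTridiagonal M) (hN : IsCyclicTridiagonal N)
    (hd : ∀ i, M i i = N i i)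
    (hp : ∀ i, M (i + 1) i * M i (i + 1) = N (i + 1) i * N i (i + 1)) :
    M.det + (-1) ^ n * (∏ i, M (i + 1) i + ∏ i, M i (i + 1)) =
      N.det + (-1) ^ n * (∏ i, N (i + 1) i + ∏ i, N i (i + 1)) := by
  have two0 := ZMod.two_ne_zero_of_three_le hn
  set τ : Equiv.Perm (ZMod n) := Equiv.addRight 1 with hτ
  have hne : τ ≠ τ⁻¹ := by
    intro h
    have := DFunLike.congr_fun h (0 : ZMod n)
    rw [eq_comm, Equiv.Perm.inv_eq_iff_eq] at this
    simp only [hτ, Equiv.coe_addRight, zero_add] at this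
    exact two0 this.symm
  have expand : ∀ L : Matrix (ZMod n) (ZMod n) A,
      L.det + (-1) ^ n * (∏ i, L (i + 1) i + ∏ i, L i (i + 1)) =
        ∑ σ ∈ univ \ {τ, τ⁻¹}, Equiv.Perm.sign σ • ∏ i, L (σ i) i := by
    intro L
    rw [det_apply, ← sum_sdiff (subset_univ {τ, τ⁻¹}), sum_pair hne, Equiv.Perm.sign_inv]
    have hs : Equiv.Perm.sign τ = -(-1) ^ n := sign_addRight_one n
    have h2 : ∏ i, L (τ⁻¹ i) i = ∏ i, L i (i + 1) := by
      rw [← Equiv.prod_comp τ]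
      simp [hτ]
    have h1 : ∏ i, L (τ i) i = ∏ i, L (i + 1) i := by simp [hτ]
    rw [hs, h1, h2]
    rcases neg_one_pow_eq_or ℤˣ n with h | h <;> rcases Nat.even_or_odd n with h' | h' <;>
      simp [h'.neg_one_pow, Units.smul_def] <;> ring
  rw [expand, expand]
  refine sum_congr rfl fun σ hσ => ?_
  simp only [mem_sdiff, mem_univ, true_and, mem_insert, mem_singleton, not_or] at hσ
  congr 1
  by_cases hb : ∀ i, σ i = i + 1 ∨ σ i = i - 1 ∨ σ i = i
  · rw [prod_perm_eq_of_adjacent hn σ hb hσ.1 hσ.2, prod_perm_eq_of_adjacent hn σ hb hσ.1 hσ.2]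
    simp only [hd, hp]
  · push Not at hb
    obtain ⟨i, h1, h2, h3⟩ := hb
    exact (prod_eq_zero (f := fun i => M (σ i) i) (mem_univ i) (hM _ _ h1 h2 h3)).trans
      (prod_eq_zero (f := fun i => N (σ i) i) (mem_univ i) (hN _ _ h1 h2 h3)).symm

section
open Polynomial

/-- The real quadratic polynomial whose complex roots are `z` and its conjugate. -/
noncomputable def conjQuadratic (z : ℂ) : ℝ[X] := X ^ 2 - C (2 * z.re) * X + C (‖z‖ ^ 2)

lemma conjQuadratic_monic (z : ℂ) : (conjQuadratic z).Monic := by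
  unfold conjQuadratic
  monicity!

lemma conjQuadratic_natDegree (z : ℂ) : (conjQuadratic z).natDegree = 2 := by
  unfold conjQuadratic
  compute_degree!

lemma eval_conjQuadratic (z : ℂ) (x : ℝ) :
    (conjQuadratic z).eval x = (x - z.re) ^ 2 + z.im ^ 2 := by
  simp only [conjQuadratic, eval_add, eval_sub, eval_pow, eval_X, eval_mul, eval_C, Complex.sq_norm,
    Complex.normSq_apply]
  ring

lemma map_conjQuadratic (z : ℂ) :
    (conjQuadratic z).map (algebraMap ℝ ℂ) = (X - C z) * (X - C (starRingEnd ℂ z)) := by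
  have h1 : ((2 * z.re : ℝ) : ℂ) = z + starRingEnd ℂ z := by
    rw [Complex.add_conj]
  have h2 : ((‖z‖ ^ 2 : ℝ) : ℂ) = z * starRingEnd ℂ z := by
    rw [Complex.mul_conj, Complex.normSq_eq_norm_sq]
  simp only [conjQuadratic, Polynomial.map_add, Polynomial.map_sub, Polynomial.map_pow, map_X,
    Polynomial.map_mul, map_C, Complex.coe_algebraMap, h1, h2]
  simp only [C_add, C_mul]
  ring

lemma roots_map_conjQuadratic_mul (z : ℂ) {g : ℝ[X]} (hg : g ≠ 0) :
    ((conjQuadratic z * g).map (algebraMap ℝ ℂ)).roots =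
      z ::ₘ starRingEnd ℂ z ::ₘ (g.map (algebraMap ℝ ℂ)).roots := by
  have hg' : g.map (algebraMap ℝ ℂ) ≠ 0 := map_ne_zero hg
  have h1 := X_sub_C_ne_zero z
  have h2 := X_sub_C_ne_zero (starRingEnd ℂ z)
  rw [Polynomial.map_mul, map_conjQuadratic, roots_mul (mul_ne_zero (mul_ne_zero h1 h2) hg'),
    roots_mul (mul_ne_zero h1 h2), roots_X_sub_C, roots_X_sub_C]
  simp [Multiset.singleton_add]

lemma neg_one_pow_card_roots_re_gt_mul_eval_pos (x : ℝ) (g : ℝ[X]) (hg : g.Monic)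
    (hx : g.eval x ≠ 0) :
    0 < (-1) ^ ((g.map (algebraMap ℝ ℂ)).roots.filter (x < ·.re)).card * g.eval x := by
  induction h : g.natDegree using Nat.strong_induction_on generalizing g with
  | _ d ih =>
  rcases Nat.eq_zero_or_pos d with h0 | h0
  · rw [hg.natDegree_eq_zero.mp (h.trans h0)]
    simp
  obtain ⟨z, hz⟩ := IsAlgClosed.exists_aeval_eq_zero ℂ g
    (by rw [degree_eq_natDegree hg.ne_zero, h]; exact_mod_cast h0.ne')
  by_cases hi : z.im = 0
  · have hzr : (algebraMap ℝ ℂ) z.re = z := Complex.ext rfl (by simp [hi])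
    have hroot : g.IsRoot z.re := by
      rw [← hzr, aeval_algebraMap_apply, map_eq_zero_iff _ (algebraMap ℝ ℂ).injective] at hz
      simpa using hz
    obtain ⟨g₁, rfl⟩ := dvd_iff_isRoot.mpr hroot
    have hm : g₁.Monic := (monic_X_sub_C _).of_mul_monic_left hg
    rw [eval_mul] at hx
    have := ih g₁.natDegree (by
      rw [← h, (monic_X_sub_C _).natDegree_mul hm, natDegree_X_sub_C]; omega) g₁ hm
      (right_ne_zero_of_mul hx) rfl
    have hr : (((X - C z.re) * g₁).map (algebraMap ℝ ℂ)).roots =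
        z ::ₘ (g₁.map (algebraMap ℝ ℂ)).roots := by
      rw [Polynomial.map_mul, roots_mul (by
        rw [← Polynomial.map_mul]; exact (hg.map _).ne_zero)]
      simp only [Polynomial.map_sub, map_X, map_C, hzr, roots_X_sub_C, Multiset.singleton_add]
    rw [hr, eval_mul]
    have hx1 := left_ne_zero_of_mul hx
    simp only [eval_sub, eval_X, eval_C] at hx1 ⊢
    rcases lt_or_gt_of_ne hx1 with h1 | h1
    · rw [Multiset.filter_cons_of_pos _ (by linarith), Multiset.card_cons, pow_succ]
      nlinarith
    · rw [Multiset.filter_cons_of_neg _ (by linarith)]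
      nlinarith
  · obtain ⟨g₁, hg₁⟩ := quadratic_dvd_of_aeval_eq_zero_im_ne_zero g hz hi
    change g = conjQuadratic z * g₁ at hg₁
    subst hg₁
    have hm : g₁.Monic := (conjQuadratic_monic z).of_mul_monic_left hg
    rw [eval_mul] at hx
    have := ih g₁.natDegree (by
      rw [← h, (conjQuadratic_monic z).natDegree_mul hm, conjQuadratic_natDegree]; omega) g₁ hm
      (right_ne_zero_of_mul hx) rfl
    have hpos : 0 < (conjQuadratic z).eval x := by rw [eval_conjQuadratic]; positivity
    rw [roots_map_conjQuadratic_mul z hm.ne_zero, eval_mul]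
    by_cases h1 : x < z.re
    · rw [Multiset.filter_cons_of_pos (p := fun w : ℂ => x < w.re) _ h1,
        Multiset.filter_cons_of_pos _ (by simpa using h1),
        Multiset.card_cons, Multiset.card_cons, pow_succ, pow_succ]
      nlinarith
    · rw [Multiset.filter_cons_of_neg (p := fun w : ℂ => x < w.re) _ h1,
        Multiset.filter_cons_of_neg _ (by simpa using h1)]
      nlinarith

lemma prod_sq_add_strictMonoOn {ι : Type*} [Fintype ι] [Nonempty ι] (a : ι → ℝ) :
    StrictMonoOn (fun T : ℝ => ∏ i, (a i ^ 2 + T)) (Set.Ici 0) := by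
  intro S hS T hT hST
  have hS : 0 ≤ S := hS
  have hpos : 0 < ∏ i, (a i ^ 2 + T) := prod_pos fun i _ => by
    have := sq_nonneg (a i)
    linarith
  by_cases h : ∃ i, a i ^ 2 + S = 0
  · obtain ⟨i, hi⟩ := h
    change ∏ i, (a i ^ 2 + S) < _
    rwa [prod_eq_zero (mem_univ i) hi]
  · push Not at h
    refine prod_lt_prod_of_nonempty (fun i _ => ?_) (fun i _ => by linarith) univ_nonempty
    exact lt_of_le_of_ne (by positivity) (h i).symm

lemma normSq_aeval_prod {ι : Type*} [Fintype ι] (e : ι → ℝ) (z : ℂ) :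
    Complex.normSq (aeval z (∏ i, (X - C (e i)))) = ∏ i, ((z.re - e i) ^ 2 + z.im ^ 2) := by
  rw [map_prod, map_prod]
  refine prod_congr rfl fun i _ => ?_
  simp [Complex.normSq_apply]
  ring

lemma im_eq_zero_of_derivative_prod {ι : Type*} [Fintype ι] [Nonempty ι] (e : ι → ℝ) (z : ℂ)
    (hz : aeval z (derivative (∏ i, (X - C (e i)) : ℝ[X])) = 0) : z.im = 0 := by
  set Q : ℝ[X] := ∏ i, (X - C (e i)) with hQ
  have hm : Q.Monic := monic_prod_of_monic _ _ fun i _ => monic_X_sub_C _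
  have hdeg : Q.natDegree = Fintype.card ι := by
    rw [hQ, natDegree_prod_of_monic _ _ fun i _ => monic_X_sub_C _]
    simp
  have hcard : 0 < Fintype.card ι := Fintype.card_pos
  have hd : derivative Q ≠ 0 := fun h => by
    have := derivative_eq_zero.mp h
    omega
  have hmem : z ∈ (derivative (Q.map (algebraMap ℝ ℂ))).rootSet ℂ := by
    rw [derivative_map, mem_rootSet]
    refine ⟨map_ne_zero hd, ?_⟩
    simpa [aeval_def, eval₂_map] using hz
  have hconv := rootSet_derivative_subset_convexHull_rootSet (by
    rw [degree_map, degree_eq_natDegree hm.ne_zero, hdeg]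
    exact_mod_cast hcard) hmem
  have hsub : (Q.map (algebraMap ℝ ℂ)).rootSet ℂ ⊆ {w : ℂ | w.im = 0} := by
    intro w hw
    have hw := (mem_rootSet.mp hw).2
    have hw : aeval w Q = 0 := by simpa [aeval_def, eval₂_map] using hw
    have h := normSq_aeval_prod e w
    rw [← hQ, hw, map_zero, eq_comm, prod_eq_zero_iff] at h
    obtain ⟨i, -, hi⟩ := h
    change w.im = 0
    nlinarith [sq_nonneg (w.re - e i), sq_nonneg w.im]
  exact convexHull_min hsub (convex_hyperplane (𝕜 := ℝ) Complex.imLm.isLinear 0) hconv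

lemma aeval_conjQuadratic (z w : ℂ) :
    aeval w (conjQuadratic z) = (w - z) * (w - starRingEnd ℂ z) := by
  rw [← eval_map_algebraMap, map_conjQuadratic]
  simp

lemma im_sq_eq_of_aeval_prod_eq {ι : Type*} [Fintype ι] [Nonempty ι] (e : ι → ℝ) {z w : ℂ}
    (h : aeval z (∏ i, (X - C (e i)) : ℝ[X]) = aeval w (∏ i, (X - C (e i)) : ℝ[X]))
    (hre : z.re = w.re) : z.im ^ 2 = w.im ^ 2 := by
  have h1 := normSq_aeval_prod e z
  rw [h, normSq_aeval_prod, hre] at h1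
  exact ((prod_sq_add_strictMonoOn fun i => w.re - e i).injOn (sq_nonneg w.im) (sq_nonneg z.im)
    h1).symm

lemma eval_neg_of_X_sub_C_sq_mul {ι : Type*} [Fintype ι] [Nonempty ι] (e : ι → ℝ) {c : ℝ}
    (hc : 0 < c) (x : ℝ) {g : ℝ[X]}
    (hg : ∏ i, (X - C (e i)) - C c = (X - C x) ^ 2 * g) : g.eval x < 0 := by
  classical
  have hQ : ∏ i, (X - C (e i)) = (X - C x) ^ 2 * g + C c := by rw [← hg]; ring
  have hval : ∏ i, (x - e i) = c := by
    have := congrArg (eval x) hQ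
    simpa [eval_prod] using this
  have hval2 : ∏ i, (x - e i) ^ 2 = c ^ 2 := by rw [prod_pow, hval]
  have hne : ∀ i, 0 < (x - e i) ^ 2 := fun i => by
    have := prod_ne_zero_iff.mp (hval.trans_ne hc.ne') i (mem_univ i)
    positivity
  obtain ⟨i₀⟩ := ‹Nonempty ι›
  have key : ∀ t : ℝ, t ≠ 0 → c ^ 2 / (x - e i₀) ^ 2 ≤
      -2 * c * (aeval (x + t * Complex.I) g).re +
        t ^ 2 * Complex.normSq (aeval (x + t * Complex.I) g) := by
    intro t ht
    have h1 := normSq_aeval_prod e (x + t * Complex.I)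
    rw [hQ] at h1
    have h2 : aeval (x + t * Complex.I) ((X - C x) ^ 2 * g + C c) =
        -((t ^ 2 : ℝ) : ℂ) * aeval (x + t * Complex.I) g + c := by
      simp [mul_pow]
    rw [h2] at h1
    set G := aeval (x + t * Complex.I) g
    have h3 : Complex.normSq (-((t ^ 2 : ℝ) : ℂ) * G + c) =
        c ^ 2 - 2 * c * t ^ 2 * G.re + t ^ 4 * Complex.normSq G := by
      rw [← Complex.ofReal_neg, Complex.normSq_apply, Complex.normSq_apply, Complex.add_re,
        Complex.add_im, Complex.re_ofReal_mul, Complex.im_ofReal_mul, Complex.ofReal_re,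
        Complex.ofReal_im]
      ring
    have h4 : c ^ 2 + t ^ 2 * (c ^ 2 / (x - e i₀) ^ 2) ≤ ∏ i, ((x - e i) ^ 2 + t ^ 2) := by
      rw [← hval2, ← mul_prod_erase univ (fun i => (x - e i) ^ 2) (mem_univ i₀),
        ← mul_prod_erase univ (fun i => (x - e i) ^ 2 + t ^ 2) (mem_univ i₀),
        mul_div_cancel_left₀ _ (hne i₀).ne', ← add_mul]
      exact mul_le_mul_of_nonneg_left
        (prod_le_prod (fun i _ => (hne i).le) fun i _ => by nlinarith [sq_nonneg t]) (by positivity)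
    rw [h3] at h1
    simp only [Complex.add_re, Complex.ofReal_re, Complex.mul_re, Complex.I_re, mul_zero,
      Complex.ofReal_im, Complex.I_im, mul_one, sub_self, add_zero, Complex.add_im, Complex.mul_im,
      zero_add] at h1
    rw [← h1] at h4
    have ht2 : 0 < t ^ 2 := by positivity
    refine le_of_mul_le_mul_left ?_ ht2
    linarith [h4]
  have hcont : Continuous fun t : ℝ => -2 * c * (aeval (x + t * Complex.I) g).re +
      t ^ 2 * Complex.normSq (aeval (x + t * Complex.I) g) := by
    have : Continuous fun t : ℝ => aeval ((x : ℂ) + t * Complex.I) g :=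
      g.continuous_aeval.comp (by fun_prop)
    have h2 := Complex.continuous_normSq.comp this
    have h3 := Complex.continuous_re.comp this
    exact (continuous_const.mul h3).add ((continuous_pow 2).mul h2)
  have hlim := ge_of_tendsto
    ((hcont.tendsto 0).mono_left (nhdsWithin_le_nhds (s := {(0 : ℝ)}ᶜ)))
    (Filter.eventually_of_mem self_mem_nhdsWithin key)
  have hg0 : aeval ((x : ℂ) + ((0 : ℝ) : ℂ) * Complex.I) g = ((g.eval x : ℝ) : ℂ) := by
    rw [Complex.ofReal_zero, zero_mul, add_zero]
    exact (aeval_algebraMap_apply ℂ x g).trans (by simp)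
  rw [hg0, Complex.ofReal_re] at hlim
  have : 0 < c ^ 2 / (x - e i₀) ^ 2 := div_pos (by positivity) (hne i₀)
  nlinarith

lemma eval_neg_of_conjQuadratic_mul {ι : Type*} [Fintype ι] [Nonempty ι] (e : ι → ℝ) {c : ℝ}
    (hc : 0 < c) (z : ℂ) {g : ℝ[X]}
    (hg : ∏ i, (X - C (e i)) - C c = conjQuadratic z * g) : g.eval z.re < 0 := by
  by_cases hz : z.im = 0
  · refine eval_neg_of_X_sub_C_sq_mul e hc z.re (hg.trans ?_)
    congr 1
    have : ‖z‖ ^ 2 = z.re ^ 2 := by rw [Complex.sq_norm, Complex.normSq_apply, hz]; ring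
    rw [conjQuadratic, this]
    simp only [C_mul, C_pow, map_ofNat]
    ring
  · have hQ : ∏ i, (X - C (e i)) = conjQuadratic z * g + C c := by rw [← hg]; ring
    have h1 := normSq_aeval_prod e z
    have h2 := normSq_aeval_prod e z.re
    have h3 : aeval z (conjQuadratic z * g + C c) = (c : ℂ) := by
      rw [map_add, map_mul, aeval_conjQuadratic]
      simp
    have h4 : aeval (z.re : ℂ) (∏ i, (X - C (e i)) : ℝ[X]) =
        ((z.im ^ 2 * g.eval z.re + c : ℝ) : ℂ) := by
      rw [hQ]
      refine (aeval_algebraMap_apply ℂ z.re _).trans ?_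
      simp [eval_conjQuadratic]
    rw [hQ, h3, Complex.normSq_ofReal] at h1
    rw [h4, Complex.normSq_ofReal] at h2
    simp only [Complex.ofReal_re, Complex.ofReal_im] at h2
    have hpos : 0 < z.im ^ 2 := by positivity
    have hlt := prod_sq_add_strictMonoOn (fun i => z.re - e i)
      (show (0 : ℝ) ^ 2 ∈ Set.Ici 0 by simp) (sq_nonneg z.im) (by simpa using hpos)
    simp only [← h1, ← h2] at hlt
    by_contra! hcon
    have : 0 ≤ z.im ^ 2 * g.eval z.re := by positivity
    nlinarith

lemma re_ne_of_mem_roots_of_conjQuadratic_mul {ι : Type*} [Fintype ι] [Nonempty ι] (e : ι → ℝ)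
    {c : ℝ} (hc : 0 < c) (z : ℂ) {g : ℝ[X]}
    (hg : ∏ i, (X - C (e i)) - C c = conjQuadratic z * g) {w : ℂ} (hw : aeval w g = 0) :
    w.re ≠ z.re := by
  intro hre
  have hQ : ∏ i, (X - C (e i)) = conjQuadratic z * g + C c := by rw [← hg]; ring
  have hneg := eval_neg_of_conjQuadratic_mul e hc z hg
  have him := im_sq_eq_of_aeval_prod_eq e (z := w) (w := z) (by
    rw [hQ, map_add, map_add, map_mul, map_mul, hw, aeval_conjQuadratic z z]; simp) hre
  have hz : aeval z g = 0 := by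
    rcases sq_eq_sq_iff_eq_or_eq_neg.mp him with h | h
    · rwa [← Complex.ext hre h]
    · have : z = starRingEnd ℂ w := Complex.ext (by simp [hre]) (by simp [h])
      rw [this, aeval_conj, hw, map_zero]
  have him0 : z.im = 0 := by
    refine im_eq_zero_of_derivative_prod e z ?_
    rw [hQ]
    obtain ⟨k, hk⟩ : (X - C z) ∣ g.map (algebraMap ℝ ℂ) :=
      dvd_iff_isRoot.mpr (by simpa [IsRoot, eval_map_algebraMap] using hz)
    rw [← eval_map_algebraMap, ← derivative_map, Polynomial.map_add, Polynomial.map_mul,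
      map_conjQuadratic, hk]
    simp
  have hzr : (z.re : ℂ) = z := Complex.ext rfl (by simp [him0])
  have : aeval ((algebraMap ℝ ℂ) z.re) g = 0 := by rw [Complex.coe_algebraMap, hzr, hz]
  rw [aeval_algebraMap_apply, map_eq_zero_iff _ (algebraMap ℝ ℂ).injective] at this
  rw [← coe_aeval_eq_eval, this] at hneg
  exact lt_irrefl _ hneg

lemma exists_conjQuadratic_dvd {p : ℝ[X]} (hp : p ≠ 0) {x : ℝ}
    (h : 2 ≤ ((p.map (algebraMap ℝ ℂ)).roots.filter (·.re = x)).card) :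
    ∃ z : ℂ, z.re = x ∧ conjQuadratic z ∣ p := by
  by_cases hex : ∃ z ∈ (p.map (algebraMap ℝ ℂ)).roots, z.re = x ∧ z.im ≠ 0
  · obtain ⟨z, hz, hre, him⟩ := hex
    refine ⟨z, hre, quadratic_dvd_of_aeval_eq_zero_im_ne_zero p ?_ him⟩
    rw [← eval_map_algebraMap]
    exact (mem_roots'.mp hz).2
  · push Not at hex
    refine ⟨x, Complex.ofReal_re x, ?_⟩
    have hfilter : (p.map (algebraMap ℝ ℂ)).roots.filter (·.re = x) =
        (p.map (algebraMap ℝ ℂ)).roots.filter (· = (algebraMap ℝ ℂ x)) := by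
      refine Multiset.filter_congr fun z hz => ⟨fun h => ?_, fun h => by simp [h]⟩
      exact Complex.ext (by simpa using h) (by simpa using hex z hz h)
    rw [hfilter, Multiset.filter_eq', Multiset.card_replicate, count_roots,
      ← eq_rootMultiplicity_map (algebraMap ℝ ℂ).injective, le_rootMultiplicity_iff hp] at h
    convert h using 1
    have : ‖(x : ℂ)‖ ^ 2 = x ^ 2 := by simp
    rw [conjQuadratic, this, Complex.ofReal_re]
    simp only [C_mul, C_pow, map_ofNat]
    ring

/-- If at least two roots of `∏ (X - eᵢ) - c` lie on a vertical line, then exactly two do, and the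
number of roots to the right of that line is odd. -/
lemma card_roots_re_eq_two_and_odd {ι : Type*} [Fintype ι] [Nonempty ι] (e : ι → ℝ)
    {c : ℝ} (hc : 0 < c) {p : ℝ[X]} (hp : p = ∏ i, (X - C (e i)) - C c) (x : ℝ)
    (h : 2 ≤ ((p.map (algebraMap ℝ ℂ)).roots.filter (·.re = x)).card) :
    ((p.map (algebraMap ℝ ℂ)).roots.filter (·.re = x)).card = 2 ∧
      Odd ((p.map (algebraMap ℝ ℂ)).roots.filter (x < ·.re)).card := by
  have hm : p.Monic := by
    rw [hp]
    refine (monic_prod_of_monic _ _ fun i _ => monic_X_sub_C _).sub_of_left ?_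
    refine degree_C_le.trans_lt ?_
    rw [degree_prod]
    simp [Fintype.card_pos]
  obtain ⟨z, rfl, g, hg⟩ := exists_conjQuadratic_dvd hm.ne_zero h
  have hgm : g.Monic := (conjQuadratic_monic z).of_mul_monic_left (hg ▸ hm)
  rw [hp] at hg
  have hneg := eval_neg_of_conjQuadratic_mul e hc z hg
  rw [hp, hg, roots_map_conjQuadratic_mul z hgm.ne_zero]
  constructor
  · rw [Multiset.filter_cons_of_pos (p := fun w : ℂ => w.re = z.re) _ rfl,
      Multiset.filter_cons_of_pos _ (by simp),
      Multiset.filter_eq_nil.mpr fun w hw => ?_]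
    · rfl
    · refine re_ne_of_mem_roots_of_conjQuadratic_mul e hc z hg ?_
      rw [← eval_map_algebraMap]
      exact (mem_roots'.mp hw).2
  · rw [Multiset.filter_cons_of_neg (p := fun w : ℂ => z.re < w.re) _ (lt_irrefl _),
      Multiset.filter_cons_of_neg _ (by simp)]
    have := neg_one_pow_card_roots_re_gt_mul_eval_pos z.re g hgm hneg.ne
    by_contra hodd
    rw [Nat.not_odd_iff_even] at hodd
    rw [hodd.neg_one_pow] at this
    linarith

/-- If the roots of `∏ (X - eᵢ) - c` are sorted by decreasing real part, then there is a strict gap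
between the entries `2m - 2` and `2m - 1`. -/
lemma re_lt_re_of_roots_eq {ι : Type*} [Fintype ι] [Nonempty ι] (e : ι → ℝ)
    {c : ℝ} (hc : 0 < c) {p : ℝ[X]} (hp : p = ∏ i, (X - C (e i)) - C c) {n : ℕ} (lam : Fin n → ℂ)
    (hroots : (p.map (algebraMap ℝ ℂ)).roots = Multiset.map lam univ.val)
    (hsort : ∀ i j : Fin n, i ≤ j → (lam j).re ≤ (lam i).re)
    (a b : Fin n) (hab : a < b) (ha : Even (a : ℕ)) : (lam b).re < (lam a).re := by
  by_contra! hcon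
  have heq : (lam b).re = (lam a).re := le_antisymm (hsort a b hab.le) hcon
  have hcard : ∀ (q : ℂ → Prop) [DecidablePred q],
      ((p.map (algebraMap ℝ ℂ)).roots.filter q).card = #{i | q (lam i)} := by
    intro q _
    rw [hroots, Multiset.filter_map, Multiset.card_map]
    rfl
  have hsub : ({a, b} : Finset (Fin n)) ⊆ ({i | (lam i).re = (lam a).re} : Finset (Fin n)) := by
    intro i hi
    rcases mem_insert.mp hi with rfl | hi
    · simp
    · rw [mem_singleton.mp hi]
      simpa using heq
  have h2 := card_roots_re_eq_two_and_odd e hc hp (lam a).re (by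
    rw [hcard, ← card_pair hab.ne]
    exact card_le_card hsub)
  rw [hcard, hcard] at h2
  have hpair := eq_of_subset_of_card_le hsub (by rw [h2.1, card_pair hab.ne])
  have hIio : ({i | (lam a).re < (lam i).re} : Finset (Fin n)) = Iio a := by
    ext i
    simp only [mem_filter, mem_univ, true_and, mem_Iio]
    refine ⟨fun h => ?_, fun h => ?_⟩
    · by_contra! hle
      exact absurd (hsort a i hle) (not_le.mpr h)
    · refine lt_of_le_of_ne (hsort i a h.le) fun he => ?_
      have hi : i ∈ ({a, b} : Finset (Fin n)) := by
        rw [hpair]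
        simpa using he.symm
      rcases mem_insert.mp hi with rfl | hi
      · exact lt_irrefl _ h
      · rw [mem_singleton.mp hi] at h
        exact lt_asymm h hab
  rw [hIio, Fin.card_Iio] at h2
  exact Nat.not_odd_iff_even.mpr ha h2.2

end

lemma IsCyclicTridiagonal.charpoly_add_eq {n : ℕ} [NeZero n] (hn : 3 ≤ n) {A : Type*} [CommRing A]
    {M N : Matrix (ZMod n) (ZMod n) A} (hM : IsCyclicTridiagonal M) (hN : IsCyclicTridiagonal N)
    (hd : ∀ i, M i i = N i i)
    (hp : ∀ i, M (i + 1) i * M i (i + 1) = N (i + 1) i * N i (i + 1)) :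
    M.charpoly + Polynomial.C (∏ i, M (i + 1) i + ∏ i, M i (i + 1)) =
      N.charpoly + Polynomial.C (∏ i, N (i + 1) i + ∏ i, N i (i + 1)) := by
  have h1 : ∀ i : ZMod n, i + 1 ≠ i := fun i => by
    simpa using ZMod.one_ne_zero_of_three_le hn
  have hchar : ∀ {L : Matrix (ZMod n) (ZMod n) A}, IsCyclicTridiagonal L →
      IsCyclicTridiagonal L.charmatrix := fun {L} hL j i hj1 hj2 hj3 => by
    rw [charmatrix_apply_ne _ _ _ hj3, hL j i hj1 hj2 hj3, Polynomial.C_0, neg_zero]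
  have hprod : ∀ f : ZMod n → A, ∏ i, -Polynomial.C (f i) = (-1) ^ n * Polynomial.C (∏ i, f i) :=
    fun f => by rw [prod_neg, ← map_prod, card_univ, ZMod.card]
  have key := (hchar hM).det_sub_eq hn (hchar hN)
    (fun i => by rw [charmatrix_apply_eq, charmatrix_apply_eq, hd])
    (fun i => by
      simp only [charmatrix_apply_ne _ _ _ (h1 i), charmatrix_apply_ne _ _ _ (h1 i).symm,
        neg_mul_neg, ← Polynomial.C_mul, hp])
  simp only [charmatrix_apply_ne _ _ _ (h1 _), charmatrix_apply_ne _ _ _ (h1 _).symm, hprod,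
    ← mul_add, ← mul_assoc, ← pow_add, Even.neg_one_pow ⟨n, rfl⟩, one_mul,
    ← Polynomial.C_add] at key
  exact key

/-- The cyclic tridiagonal matrix with entries `b i` at `(i + 1, i)`, `a i` at `(i - 1, i)` and
`d i` on the diagonal. -/
def cyclicTridiagonal {n : ℕ} {A : Type*} [Zero A] (b a d : ZMod n → A) :
    Matrix (ZMod n) (ZMod n) A :=
  Matrix.of fun j i =>
    if j = i + 1 then b i else if j = i - 1 then a i else if j = i then d i else 0

lemma cyclicTridiagonal_isCyclicTridiagonal {n : ℕ} {A : Type*} [Zero A] (b a d : ZMod n → A) :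
    IsCyclicTridiagonal (cyclicTridiagonal b a d) := fun j i h1 h2 h3 => by
  simp [cyclicTridiagonal, h1, h2, h3]

lemma cyclicTridiagonal_succ_self {n : ℕ} {A : Type*} [Zero A] (b a d : ZMod n → A) (i : ZMod n) :
    cyclicTridiagonal b a d (i + 1) i = b i := by
  simp [cyclicTridiagonal]

lemma cyclicTridiagonal_self_succ {n : ℕ} (hn : 3 ≤ n) {A : Type*} [Zero A] (b a d : ZMod n → A)
    (i : ZMod n) : cyclicTridiagonal b a d i (i + 1) = a (i + 1) := by
  have two0 := ZMod.two_ne_zero_of_three_le hn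
  have e1 : i ≠ i + 1 + 1 := by rw [add_assoc, Ne, left_eq_add]; exact two0
  simp [cyclicTridiagonal, e1]

lemma cyclicTridiagonal_self {n : ℕ} (hn : 3 ≤ n) {A : Type*} [Zero A] (b a d : ZMod n → A)
    (i : ZMod n) : cyclicTridiagonal b a d i i = d i := by
  have one0 := ZMod.one_ne_zero_of_three_le hn
  have e1 : i ≠ i + 1 := by simpa using one0
  have e2 : i ≠ i - 1 := fun h => one0 (by simpa using h.symm)
  simp only [cyclicTridiagonal, of_apply, e1, e2, if_false, if_true]

lemma cyclicTridiagonal_isHermitian {n : ℕ} (hn : 3 ≤ n) {b a d : ZMod n → ℂ}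
    (hd : ∀ i, star (d i) = d i) (hab : ∀ i, a (i + 1) = star (b i)) :
    (cyclicTridiagonal b a d).IsHermitian := by
  refine IsHermitian.ext fun i j => ?_
  by_cases h1 : i = j + 1
  · subst h1
    rw [cyclicTridiagonal_self_succ hn, cyclicTridiagonal_succ_self, hab, star_star]
  by_cases h2 : j = i + 1
  · subst h2
    rw [cyclicTridiagonal_self_succ hn, cyclicTridiagonal_succ_self, hab]
  by_cases h3 : i = j
  · subst h3
    rw [cyclicTridiagonal_self hn, hd]
  · rw [cyclicTridiagonal_isCyclicTridiagonal b a d i j h1 (fun h => h2 (by simp [h])) h3,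
      cyclicTridiagonal_isCyclicTridiagonal b a d j i h2 (fun h => h1 (by simp [h]))
        (fun h => h3 h.symm), star_zero]

lemma uniGenC_eq_cyclicTridiagonal (n : ℕ) [NeZero n] (kp km : ZMod n → ℝ) :
    uniGenC n kp km = cyclicTridiagonal (fun i => (kp i : ℂ)) (fun i => (km i : ℂ))
      (fun i => -((kp i : ℂ) + (km i : ℂ))) := rfl

/-- Replacing the rates by the off-diagonal entries `√(kp i * km (i + 1))`, up to a single phase
`±I` on one edge, gives a Hermitian matrix whose two cycle weights cancel. -/
lemma exists_charpoly_uniGenC_eq {n : ℕ} [NeZero n] (hn : 3 ≤ n) {kp km : ZMod n → ℝ}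
    (hkp : ∀ i, 0 ≤ kp i) (hkm : ∀ i, 0 ≤ km i) :
    ∃ e : ZMod n → ℝ, (uniGenC n kp km).charpoly =
      (∏ i, (Polynomial.X - Polynomial.C (e i)) -
        Polynomial.C (∏ i, kp i + ∏ i, km i)).map (algebraMap ℝ ℂ) := by
  set w : ZMod n → ℂ := fun i => (Real.sqrt (kp i * km (i + 1)) : ℂ) with hw
  set b : ZMod n → ℂ := fun i => (if i = 0 then Complex.I else 1) * w i with hb
  set a : ZMod n → ℂ := fun i => star (b (i - 1)) with ha
  set d : ZMod n → ℂ := fun i => -((kp i : ℂ) + (km i : ℂ)) with hd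
  have hab : ∀ i, a (i + 1) = star (b i) := fun i => by simp [ha]
  have hH : (cyclicTridiagonal b a d).IsHermitian :=
    cyclicTridiagonal_isHermitian hn (fun i => by simp [hd]) hab
  refine ⟨hH.eigenvalues, ?_⟩
  have hwsq : ∀ i, w i * w i = kp i * km (i + 1) := fun i => by
    simp only [hw]
    rw [← Complex.ofReal_mul, Real.mul_self_sqrt (mul_nonneg (hkp i) (hkm _)), Complex.ofReal_mul]
  have hwstar : ∀ i, star (w i) = w i := fun i => by simp [hw]
  have hphase : ∏ i : ZMod n, (if i = 0 then Complex.I else 1) = Complex.I := by simp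
  have hprodb : ∏ i, b i = Complex.I * ∏ i, w i := by rw [hb, prod_mul_distrib, hphase]
  have hproda : ∏ i, star (b i) = -(Complex.I * ∏ i, w i) := by
    rw [← star_prod, hprodb, star_mul', star_prod]
    simp only [hwstar]
    simp
  have key := (cyclicTridiagonal_isCyclicTridiagonal (fun i => (kp i : ℂ)) (fun i => (km i : ℂ))
    d).charpoly_add_eq hn (cyclicTridiagonal_isCyclicTridiagonal b a d)
    (fun i => by rw [cyclicTridiagonal_self hn, cyclicTridiagonal_self hn])
    (fun i => by
      rw [cyclicTridiagonal_self_succ hn, cyclicTridiagonal_self_succ hn,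
        cyclicTridiagonal_succ_self, cyclicTridiagonal_succ_self, hab, ← hwsq]
      simp only [hb, star_mul', hwstar]
      split_ifs
      · simp only [Complex.star_def, Complex.conj_I]
        linear_combination (w i * w i) * Complex.I_mul_I
      · simp)
  simp only [cyclicTridiagonal_self_succ hn, cyclicTridiagonal_succ_self, hab, hprodb, hproda,
    add_neg_cancel, Polynomial.C_0, add_zero] at key
  have hshift : ∏ i, (km (i + 1) : ℂ) = ∏ i, (km i : ℂ) :=
    Equiv.prod_comp (Equiv.addRight (1 : ZMod n)) (fun i => (km i : ℂ))
  rw [hshift, hH.charpoly_eq] at key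
  rw [uniGenC_eq_cyclicTridiagonal, eq_sub_of_add_eq key]
  simp [Polynomial.map_prod]

lemma sum_cyclicTridiagonal_col {n : ℕ} [NeZero n] (hn : 3 ≤ n) {A B : Type*} [Zero A]
    [AddCommMonoid B] (b a d : ZMod n → A) (f : A → B) (hf : f 0 = 0) (i : ZMod n) :
    ∑ j ∈ univ.erase i, f (cyclicTridiagonal b a d j i) = f (b i) + f (a i) := by
  have one0 := ZMod.one_ne_zero_of_three_le hn
  have two0 := ZMod.two_ne_zero_of_three_le hn
  have e1 : i + 1 ≠ i := by simpa using one0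
  have e2 : i - 1 ≠ i := by simpa using one0
  have e3 : i + 1 ≠ i - 1 := by
    rw [Ne, eq_sub_iff_add_eq, add_assoc, add_eq_left]
    exact two0
  rw [← sum_subset (s₁ := {i + 1, i - 1}), sum_pair e3]
  · simp [cyclicTridiagonal, e3.symm]
  · intro j hj
    rcases mem_insert.mp hj with rfl | hj
    · simp [e1]
    · rw [mem_singleton.mp hj]
      simp [e2]
  · intro j hj hj'
    simp only [mem_insert, mem_singleton, not_or] at hj'
    rw [cyclicTridiagonal_isCyclicTridiagonal b a d j i hj'.1 hj'.2 (ne_of_mem_erase hj), hf]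

lemma isRoot_charpoly_uniGenC_zero {n : ℕ} [NeZero n] (hn : 3 ≤ n) (kp km : ZMod n → ℝ) :
    (uniGenC n kp km).charpoly.IsRoot 0 := by
  rw [Polynomial.IsRoot, eval_charpoly, map_zero, zero_sub, ← exists_vecMul_eq_zero_iff]
  refine ⟨1, one_ne_zero, ?_⟩
  rw [vecMul_neg, neg_eq_zero]
  ext i
  rw [uniGenC_eq_cyclicTridiagonal, vecMul, one_dotProduct, ← add_sum_erase _ _ (mem_univ i),
    cyclicTridiagonal_self hn]
  refine (congrArg _ (sum_cyclicTridiagonal_col hn _ _ _ id rfl i)).trans ?_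
  simp

lemma re_neg_of_isRoot_charpoly_uniGenC {n : ℕ} [NeZero n] (hn : 3 ≤ n) {kp km : ZMod n → ℝ}
    (hkp : ∀ i, 0 ≤ kp i) (hkm : ∀ i, 0 ≤ km i) {z : ℂ}
    (hz : (uniGenC n kp km).charpoly.IsRoot z) (hz0 : z ≠ 0) : z.re < 0 := by
  by_contra! hre
  rw [Polynomial.IsRoot, eval_charpoly] at hz
  refine det_ne_zero_of_sum_col_lt_diag (fun i => ?_) hz
  have hoff : ∀ j ∈ univ.erase i, ‖(scalar (ZMod n) z - uniGenC n kp km) j i‖ =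
      ‖uniGenC n kp km j i‖ := fun j hj => by
    rw [Matrix.sub_apply, scalar_apply, diagonal_apply_ne _ (ne_of_mem_erase hj), zero_sub,
      norm_neg]
  rw [sum_congr rfl hoff, Matrix.sub_apply, scalar_apply, diagonal_apply_eq,
    uniGenC_eq_cyclicTridiagonal, sum_cyclicTridiagonal_col hn _ _ _ norm norm_zero,
    cyclicTridiagonal_self hn, sub_neg_eq_add, Complex.norm_of_nonneg (hkp i), Complex.norm_of_nonneg (hkm i), ← Complex.ofReal_add]
  have hs : 0 ≤ kp i + km i := add_nonneg (hkp i) (hkm i)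
  have hpos := Complex.normSq_pos.mpr hz0
  refine lt_of_pow_lt_pow_left₀ 2 (norm_nonneg _) ?_
  rw [Complex.normSq_apply] at hpos
  rw [Complex.sq_norm, Complex.normSq_apply, Complex.add_re, Complex.add_im, Complex.ofReal_re,
    Complex.ofReal_im]
  nlinarith [mul_nonneg hre hs]

theorem unicyclic_eigenvalue_pairing
    (n : ℕ) [NeZero n] (hn : 3 ≤ n)
    (kp km : ZMod n → ℝ) (hkp : ∀ i, 0 < kp i) (hkm : ∀ i, 0 ≤ km i)
    (lam : Fin n → ℂ)
    (hroots : (uniGenC n kp km).charpoly.roots = Multiset.map lam Finset.univ.val)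
    (hsort : ∀ i j : Fin n, i ≤ j → (lam j).re ≤ (lam i).re) :
    lam ⟨0, by omega⟩ = 0 ∧
    ∀ m : ℕ, ∀ _hm : 1 ≤ m, ∀ _h2 : 2 * m ≤ n,
      (lam ⟨2 * m - 1, by omega⟩).re < (lam ⟨2 * m - 2, by omega⟩).re := by
  constructor
  · have hne : (uniGenC n kp km).charpoly ≠ 0 := (charpoly_monic _).ne_zero
    have hmem := (Polynomial.mem_roots hne).mpr (isRoot_charpoly_uniGenC_zero hn kp km)
    rw [hroots, Multiset.mem_map] at hmem
    obtain ⟨i, -, hi⟩ := hmem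
    have h0 := hsort ⟨0, by omega⟩ i (Nat.zero_le _)
    rw [hi, Complex.zero_re] at h0
    by_contra hlam
    refine (re_neg_of_isRoot_charpoly_uniGenC hn (fun i => (hkp i).le) hkm
      ((Polynomial.mem_roots hne).mp ?_) hlam).not_ge h0
    rw [hroots]
    exact Multiset.mem_map_of_mem _ (mem_univ (α := Fin n) _)
  · intro m hm h2
    obtain ⟨e, he⟩ := exists_charpoly_uniGenC_eq hn (fun i => (hkp i).le) hkm
    have hc : 0 < ∏ i, kp i + ∏ i, km i :=
      add_pos_of_pos_of_nonneg (prod_pos fun i _ => hkp i) (prod_nonneg fun i _ => hkm i)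
    rw [he] at hroots
    exact re_lt_re_of_roots_eq e hc rfl lam hroots hsort _ _
      (Fin.mk_lt_mk.mpr (by omega)) ⟨m - 1, by simp only; omega⟩
end

section
/- Let R be the unicyclic generator on n ≥ 3 states with rates k⁺ᵢ > 0, k⁻ᵢ ≥ 0, and let λ be a nonreal eigenvalue of R with left eigenvector u (Rᵀu = λu) and right eigenvector v (Rv = λv). Then all components uᵢ and vᵢ are nonzero, the winding numbers computed from u and from v coincide: |(1/(2π)) Σᵢ Arg(u_{i+1}/uᵢ)|ₙ = |(1/(2π)) Σᵢ Arg(v_{i+1}/vᵢ)|ₙ =: w, and w ∈ {1, …, ⌈n/2⌉ − 1}. -/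
open Matrix Finset

/-- Induction around the cycle, starting at an arbitrary state. -/
lemma ZMod.cyclic_induction {n : ℕ} [NeZero n] {P : ZMod n → Prop} (j : ZMod n) (hj : P j)
    (hstep : ∀ i, P (i - 1) → P i) (i : ZMod n) : P i := by
  have key : ∀ m : ℕ, P (j + m) := by
    intro m
    induction m with
    | zero => simpa using hj
    | succ m ih =>
      apply hstep
      have h : j + ((m + 1 : ℕ) : ZMod n) - 1 = j + m := by push_cast; ring
      rwa [h]
  have h := key (i - j).val
  rwa [ZMod.natCast_zmod_val, add_sub_cancel] at h

lemma Complex.im_div_eq (x y : ℂ) :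
    (y / x).im = ((starRingEnd ℂ x) * y).im / Complex.normSq x := by
  simp only [Complex.div_im, Complex.mul_im, Complex.conj_re, Complex.conj_im]
  ring

/-- A periodic solution of a three-term recurrence with real coefficients, up to a nonreal
spectral parameter, has no zeros and rotates in a direction dictated by the coefficients. -/
lemma recurrence_rotation {n : ℕ} [NeZero n] (p q r : ZMod n → ℝ) (hp : ∀ i, 0 < p i)
    (hq : ∀ i, 0 ≤ q i) (lam : ℂ) (hlam : lam.im ≠ 0) (x : ZMod n → ℂ) (hx : x ≠ 0)
    (hrec : ∀ i, p i * x (i + 1) + q i * x (i - 1) = (lam + r i) * x i) :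
    (∀ i, x i ≠ 0) ∧
      ((∏ i, q i < ∏ i, p i ∧ ∀ i, 0 < lam.im * (x (i + 1) / x i).im) ∨
        (∏ i, p i < ∏ i, q i ∧ ∀ i, lam.im * (x (i + 1) / x i).im < 0)) := by
  obtain ⟨a, ha⟩ : ∃ a : ZMod n → ℝ,
      ∀ i, a i = lam.im * ((starRingEnd ℂ (x i)) * x (i + 1)).im := ⟨_, fun _ => rfl⟩
  have hsq : 0 < lam.im ^ 2 := by positivity
  have hbal : ∀ i, p i * a i = q i * a (i - 1) + lam.im ^ 2 * Complex.normSq (x i) := by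
    intro i
    have h := congrArg (fun z => ((starRingEnd ℂ (x i)) * z).im) (hrec i)
    rw [ha, ha, sub_add_cancel]
    simp [Complex.normSq_apply] at h ⊢
    linear_combination lam.im * h
  have hratio : ∀ i, lam.im * (x (i + 1) / x i).im = a i / Complex.normSq (x i) := by
    intro i
    rw [Complex.im_div_eq, ha]
    ring
  have hshift : ∏ i, a (i - 1) = ∏ i, a i := Equiv.prod_comp (Equiv.subRight (1 : ZMod n)) a
  by_cases hneg : ∀ i, a i < 0
  · have hne : ∀ i, x i ≠ 0 := by
      intro i h0
      have := hneg i
      simp [ha, h0] at this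
    refine ⟨hne, Or.inr ⟨?_, fun i => ?_⟩⟩
    · have h1 : ∏ i, p i * -a i < ∏ i, q i * -a (i - 1) := by
        refine Finset.prod_lt_prod_of_nonempty (fun i _ => ?_) (fun i _ => ?_) univ_nonempty
        · exact mul_pos (hp i) (neg_pos.2 (hneg i))
        · have := hbal i
          have := mul_pos hsq (Complex.normSq_pos.2 (hne i))
          linarith
      have h2 : ∏ i, -a (i - 1) = ∏ i, -a i :=
        Equiv.prod_comp (Equiv.subRight (1 : ZMod n)) fun i => -a i
      rw [Finset.prod_mul_distrib, Finset.prod_mul_distrib, h2] at h1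
      exact lt_of_mul_lt_mul_right h1 (Finset.prod_nonneg fun i _ => (neg_pos.2 (hneg i)).le)
    · rw [hratio]
      exact div_neg_of_neg_of_pos (hneg i) (Complex.normSq_pos.2 (hne i))
  · push Not at hneg
    obtain ⟨j, hj⟩ := hneg
    have hnonneg : ∀ i, 0 ≤ a i := by
      refine ZMod.cyclic_induction j hj fun i hi => ?_
      have h1 := hbal i
      have h2 := mul_nonneg (hq i) hi
      have h3 := mul_nonneg hsq.le (Complex.normSq_nonneg (x i))
      exact nonneg_of_mul_nonneg_right (by linarith : 0 ≤ p i * a i) (hp i)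
    have hne : ∀ i, x i ≠ 0 := by
      by_contra! h
      obtain ⟨i₀, hi₀⟩ := h
      have hrev : ∀ i, x (-i) = 0 := by
        refine ZMod.cyclic_induction (-i₀) (by simpa using hi₀) fun i hi => ?_
        have h0 : a (-i) = 0 := by
          rw [ha, show -i + 1 = -(i - 1) by ring, hi]
          simp
        have h1 := hbal (-i)
        rw [h0, mul_zero] at h1
        have h2 := mul_nonneg (hq (-i)) (hnonneg (-i - 1))
        have h3 := mul_nonneg hsq.le (Complex.normSq_nonneg (x (-i)))
        have h4 : lam.im ^ 2 * Complex.normSq (x (-i)) = 0 := by linarith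
        exact Complex.normSq_eq_zero.1 ((mul_eq_zero.1 h4).resolve_left hsq.ne')
      exact hx (funext fun i => by simpa using hrev (-i))
    have hlt : ∀ i, q i * a (i - 1) < p i * a i := fun i => by
      have := hbal i
      have := mul_pos hsq (Complex.normSq_pos.2 (hne i))
      linarith
    have hpos : ∀ i, 0 < a i := fun i =>
      pos_of_mul_pos_right (lt_of_le_of_lt (mul_nonneg (hq i) (hnonneg _)) (hlt i)) (hp i).le
    refine ⟨hne, Or.inl ⟨?_, fun i => ?_⟩⟩
    · by_cases hz : ∃ i, q i = 0
      · obtain ⟨i, hi⟩ := hz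
        rw [Finset.prod_eq_zero (mem_univ i) hi]
        exact Finset.prod_pos fun i _ => hp i
      · push Not at hz
        have h1 : ∏ i, q i * a (i - 1) < ∏ i, p i * a i :=
          Finset.prod_lt_prod_of_nonempty
            (fun i _ => mul_pos (lt_of_le_of_ne (hq i) (hz i).symm) (hpos _))
            (fun i _ => hlt i) univ_nonempty
        rw [Finset.prod_mul_distrib, Finset.prod_mul_distrib, hshift] at h1
        exact lt_of_mul_lt_mul_right h1 (Finset.prod_nonneg fun i _ => hnonneg i)
    · rw [hratio]
      exact div_pos (hpos i) (Complex.normSq_pos.2 (hne i))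

lemma Complex.arg_mem_Ioo_of_im_pos {z : ℂ} (hz : 0 < z.im) : z.arg ∈ Set.Ioo 0 Real.pi := by
  have h0 : 0 ≤ z.arg := Complex.arg_nonneg_iff.2 hz.le
  refine ⟨lt_of_le_of_ne h0 fun h => ?_, Complex.arg_lt_pi_iff.2 (Or.inr hz.ne')⟩
  have := (Complex.arg_eq_zero_iff.1 h.symm).2
  exact hz.ne' this

lemma Complex.arg_mem_Ioo_of_im_neg {z : ℂ} (hz : z.im < 0) : z.arg ∈ Set.Ioo (-Real.pi) 0 :=
  ⟨Complex.neg_pi_lt_arg z, Complex.arg_neg_iff.2 hz⟩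

lemma Complex.arg_mul_of_im_pos_of_im_neg {x y : ℂ} (hx : 0 < x.im) (hy : y.im < 0) :
    (x * y).arg = x.arg + y.arg := by
  have h1 := Complex.arg_mem_Ioo_of_im_pos hx
  have h2 := Complex.arg_mem_Ioo_of_im_neg hy
  refine Complex.arg_mul (fun h => by simp [h] at hx) (fun h => by simp [h] at hy) ⟨?_, ?_⟩
  · linarith [h1.1, h2.1]
  · linarith [h1.2, h2.2]

lemma Complex.inv_im_neg {z : ℂ} (hz : 0 < z.im) : (z⁻¹).im < 0 := by
  have h0 : z ≠ 0 := fun h => by simp [h] at hz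
  rw [Complex.inv_im]
  exact div_neg_of_neg_of_pos (neg_neg_of_pos hz) (Complex.normSq_pos.2 h0)

/-- Counterrotating families of ratios linked by a cocycle in the upper half-plane have opposite
total arguments. -/
lemma sum_arg_add_sum_arg_eq_zero {n : ℕ} [NeZero n] {X Y H : ZMod n → ℂ}
    (hX : ∀ i, 0 < (X i).im) (hY : ∀ i, (Y i).im < 0) (hH : ∀ i, 0 < (H i).im)
    (hrel : ∀ i, X i * Y i * H (i + 1) = H i) :
    ∑ i, (X i).arg + ∑ i, (Y i).arg = 0 := by
  have hterm : ∀ i, (X i).arg + (Y i).arg = (H i).arg - (H (i + 1)).arg := by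
    intro i
    have h0 : H (i + 1) ≠ 0 := fun h => by simpa [h] using hH (i + 1)
    have hm : X i * Y i = H i * (H (i + 1))⁻¹ := by rw [← hrel i]; field_simp
    rw [← Complex.arg_mul_of_im_pos_of_im_neg (hX i) (hY i), hm,
      Complex.arg_mul_of_im_pos_of_im_neg (hH i) (Complex.inv_im_neg (hH _)), Complex.arg_inv,
      if_neg (Complex.arg_mem_Ioo_of_im_pos (hH _)).2.ne]
    ring
  rw [← Finset.sum_add_distrib, Finset.sum_congr rfl fun i _ => hterm i, Finset.sum_sub_distrib,
    sub_eq_zero]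
  exact (Equiv.sum_comp (Equiv.addRight (1 : ZMod n)) fun i => (H i).arg).symm

lemma exists_sum_arg_eq {n : ℕ} [NeZero n] {x : ZMod n → ℂ} (hx : ∀ i, x i ≠ 0) :
    ∃ m : ℤ, ∑ i, (x (i + 1) / x i).arg = m * (2 * Real.pi) := by
  have hprod : ∏ i, x (i + 1) / x i = 1 := by
    have hshift : ∏ i, x (i + 1) = ∏ i, x i := Equiv.prod_comp (Equiv.addRight (1 : ZMod n)) x
    rw [Finset.prod_div_distrib, hshift]
    exact div_self (Finset.prod_ne_zero_iff.2 fun i _ => hx i)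
  have hexp : Complex.exp (((∑ i, (x (i + 1) / x i).arg : ℝ) : ℂ) * Complex.I) = 1 := by
    have h : ∏ i, ((‖x (i + 1) / x i‖ : ℂ) *
        Complex.exp ((x (i + 1) / x i).arg * Complex.I)) = 1 := by
      rw [← hprod]
      exact Finset.prod_congr rfl fun i _ => Complex.norm_mul_exp_arg_mul_I _
    rw [Finset.prod_mul_distrib, ← Complex.ofReal_prod, ← norm_prod, hprod, norm_one,
      Complex.ofReal_one, one_mul, ← Complex.exp_sum, ← Finset.sum_mul, ← Complex.ofReal_sum] at h
    exact h
  obtain ⟨m, hm⟩ := Complex.exp_eq_one_iff.1 hexp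
  refine ⟨m, ?_⟩
  have h := congrArg Complex.im hm
  simpa using h

lemma windingNum_eq_wrapIdx {n : ℕ} [NeZero n] {x : ZMod n → ℂ} {m : ℤ}
    (h : ∑ i, (x (i + 1) / x i).arg = m * (2 * Real.pi)) : windingNum n x = wrapIdx n m := by
  have hpi : 2 * Real.pi ≠ 0 := by positivity
  rw [windingNum, h, mul_div_cancel_right₀ _ hpi, round_intCast]

lemma wrapIdx_eq_self {n : ℕ} {m : ℤ} (h0 : 0 < m) (h1 : 2 * m < n) : wrapIdx n m = m := by
  rw [wrapIdx, Int.emod_eq_of_lt (by omega) (by omega), Int.emod_eq_of_lt (by omega) (by omega)]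
  omega

lemma wrapIdx_neg (n : ℕ) (m : ℤ) : wrapIdx n (-m) = wrapIdx n m := by
  simp [wrapIdx, sub_eq_add_neg, min_comm]

lemma windingNum_of_counterrotating {n : ℕ} [NeZero n] {x y H : ZMod n → ℂ}
    (hx : ∀ i, x i ≠ 0) (hX : ∀ i, 0 < (x (i + 1) / x i).im)
    (hY : ∀ i, (y (i + 1) / y i).im < 0) (hH : ∀ i, 0 < (H i).im)
    (hrel : ∀ i, x (i + 1) / x i * (y (i + 1) / y i) * H (i + 1) = H i) :
    windingNum n x = windingNum n y ∧ 1 ≤ windingNum n x ∧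
      windingNum n x ≤ ((n : ℤ) + 1) / 2 - 1 := by
  obtain ⟨m, hm⟩ := exists_sum_arg_eq hx
  have hsum := sum_arg_add_sum_arg_eq_zero hX hY hH hrel
  have hm' : ∑ i, (y (i + 1) / y i).arg = (-m : ℤ) * (2 * Real.pi) := by
    push_cast
    linarith
  have hlo : 0 < ∑ i, (x (i + 1) / x i).arg :=
    Finset.sum_pos (fun i _ => (Complex.arg_mem_Ioo_of_im_pos (hX i)).1) univ_nonempty
  have hhi : ∑ i, (x (i + 1) / x i).arg < ∑ _i : ZMod n, Real.pi :=
    Finset.sum_lt_sum_of_nonempty univ_nonempty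
      fun i _ => (Complex.arg_mem_Ioo_of_im_pos (hX i)).2
  rw [Finset.sum_const, card_univ, ZMod.card, nsmul_eq_mul] at hhi
  rw [hm] at hlo hhi
  have h0 : 0 < m := by
    exact_mod_cast (pos_of_mul_pos_left hlo (by positivity) : (0 : ℝ) < m)
  have h1 : 2 * m < n := by
    have : (2 * m : ℝ) < n :=
      lt_of_mul_lt_mul_right (by linarith : (2 * m : ℝ) * Real.pi < n * Real.pi) Real.pi_pos.le
    exact_mod_cast this
  rw [windingNum_eq_wrapIdx hm, windingNum_eq_wrapIdx hm', wrapIdx_neg, wrapIdx_eq_self h0 h1]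
  omega

lemma ZMod.add_one_ne_sub_one {n : ℕ} (hn : 3 ≤ n) (i : ZMod n) : i + 1 ≠ i - 1 := by
  intro h
  have h2 : ((2 : ℕ) : ZMod n) = 0 := by
    push_cast
    linear_combination h
  exact absurd (Nat.le_of_dvd (by norm_num) ((ZMod.natCast_eq_zero_iff 2 n).1 h2)) (by omega)

lemma uniGenC_apply {n : ℕ} [NeZero n] (hn : 3 ≤ n) (kp km : ZMod n → ℝ) (j i : ZMod n) :
    uniGenC n kp km j i = (if j = i + 1 then (kp i : ℂ) else 0) +
      (if j = i - 1 then (km i : ℂ) else 0) +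
      (if j = i then -((kp i : ℂ) + (km i : ℂ)) else 0) := by
  have h1 := ZMod.one_ne_zero_of_three_le hn
  have h2 : i + 1 ≠ i - 1 := ZMod.add_one_ne_sub_one hn i
  have h3 : i + 1 ≠ i := by simpa using h1
  have h4 : i - 1 ≠ i := by simpa using h1
  rw [uniGenC, Matrix.of_apply]
  by_cases hf : j = i + 1
  · subst hf
    rw [if_pos rfl, if_pos rfl, if_neg h2, if_neg h3, add_zero, add_zero]
  · by_cases hb : j = i - 1
    · subst hb
      rw [if_neg hf, if_pos rfl, if_neg hf, if_pos rfl, if_neg h4, zero_add, add_zero]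
    · rw [if_neg hf, if_neg hb, if_neg hf, if_neg hb, zero_add, zero_add]

lemma uniGenC_transpose_mulVec {n : ℕ} [NeZero n] (hn : 3 ≤ n) (kp km : ZMod n → ℝ) (u : ZMod n → ℂ) (i : ZMod n) :
    ((uniGenC n kp km)ᵀ *ᵥ u) i =
      kp i * u (i + 1) + km i * u (i - 1) - (kp i + km i) * u i := by
  simp only [Matrix.mulVec, dotProduct, Matrix.transpose_apply, uniGenC_apply hn, add_mul,
    ite_mul, zero_mul, Finset.sum_add_distrib, Finset.sum_ite_eq', mem_univ, if_true]
  ring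

lemma uniGenC_mulVec {n : ℕ} [NeZero n] (hn : 3 ≤ n) (kp km : ZMod n → ℝ) (v : ZMod n → ℂ) (i : ZMod n) :
    (uniGenC n kp km *ᵥ v) i =
      kp (i - 1) * v (i - 1) + km (i + 1) * v (i + 1) - (kp i + km i) * v i := by
  have h1 : ∀ j : ZMod n, i = j + 1 ↔ i - 1 = j := fun j => sub_eq_iff_eq_add.symm
  have h2 : ∀ j : ZMod n, i = j - 1 ↔ i + 1 = j := fun j => eq_sub_iff_add_eq
  simp only [Matrix.mulVec, dotProduct, uniGenC_apply hn, h1, h2, add_mul,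
    ite_mul, zero_mul, Finset.sum_add_distrib, Finset.sum_ite_eq, mem_univ, if_true]
  ring

theorem unicyclic_left_right_winding
    (n : ℕ) [NeZero n] (hn : 3 ≤ n)
    (kp km : ZMod n → ℝ) (hkp : ∀ i, 0 < kp i) (hkm : ∀ i, 0 ≤ km i)
    (lam : ℂ) (hlam : lam.im ≠ 0)
    (u v : ZMod n → ℂ) (hu : u ≠ 0) (hv : v ≠ 0)
    (hleft : (uniGenC n kp km)ᵀ *ᵥ u = lam • u)
    (hright : uniGenC n kp km *ᵥ v = lam • v) :
    (∀ i, u i ≠ 0) ∧ (∀ i, v i ≠ 0) ∧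
    windingNum n u = windingNum n v ∧
    1 ≤ windingNum n u ∧ windingNum n u ≤ ((n : ℤ) + 1) / 2 - 1 := by
  have hL : ∀ i, kp i * u (i + 1) + km i * u (i - 1) = (lam + (kp i + km i : ℝ)) * u i := by
    intro i
    have h := congrFun hleft i
    rw [uniGenC_transpose_mulVec hn, Pi.smul_apply, smul_eq_mul] at h
    push_cast
    linear_combination h
  have hR : ∀ i, kp (i - 1) * v (i - 1) + km (i + 1) * v (i + 1) =
      (lam + (kp i + km i : ℝ)) * v i := by
    intro i
    have h := congrFun hright i
    rw [uniGenC_mulVec hn, Pi.smul_apply, smul_eq_mul] at h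
    push_cast
    linear_combination h
  obtain ⟨hu0, hudir⟩ := recurrence_rotation kp km (fun i => kp i + km i) hkp hkm lam hlam u hu hL
  obtain ⟨hv0', hvdir'⟩ := recurrence_rotation (fun i => kp (-i - 1)) (fun i => km (-i + 1))
    (fun i => kp (-i) + km (-i)) (fun i => hkp _) (fun i => hkm _) lam hlam (fun i => v (-i))
    (fun h => hv (funext fun i => by simpa using congrFun h (-i)))
    (fun i => by
      rw [show -(i + 1) = -i - 1 by ring, show -(i - 1) = -i + 1 by ring]
      exact hR (-i))
  have hv0 : ∀ i, v i ≠ 0 := fun i => by simpa using hv0' (-i)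
  have hprodp : ∏ i, kp (-i - 1) = ∏ i, kp i :=
    Equiv.prod_comp ((Equiv.neg (ZMod n)).trans (Equiv.subRight 1)) kp
  have hprodm : ∏ i, km (-i + 1) = ∏ i, km i :=
    Equiv.prod_comp ((Equiv.neg (ZMod n)).trans (Equiv.addRight 1)) km
  rw [hprodp, hprodm] at hvdir'
  have hflip : ∀ i, ∃ c : ℝ, 0 < c ∧ lam.im * (v (-(-(i + 1) + 1)) / v (-(-(i + 1)))).im =
      -(c * (lam.im * (v (i + 1) / v i).im)) := by
    intro i
    have hi := Complex.normSq_pos.2 (hv0 i)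
    have hi1 := Complex.normSq_pos.2 (hv0 (i + 1))
    refine ⟨Complex.normSq (v i) / Complex.normSq (v (i + 1)), div_pos hi hi1, ?_⟩
    rw [show -(-(i + 1) + 1) = i by ring, neg_neg, Complex.im_div_eq, Complex.im_div_eq]
    simp only [Complex.mul_im, Complex.conj_re, Complex.conj_im]
    field_simp
    ring
  refine ⟨hu0, hv0, ?_⟩
  obtain ⟨H, hHdef⟩ : ∃ H : ZMod n → ℂ, ∀ i, H i =
      kp i * (u (i + 1) / u i) - km (i + 1) * (v (i + 1) / v i) := ⟨_, fun _ => rfl⟩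
  have hrel : ∀ i, u (i + 1) / u i * (v (i + 1) / v i) * H (i + 1) = H i := by
    intro i
    have h1 := hL (i + 1)
    have h2 := hR (i + 1)
    rw [add_sub_cancel_right] at h1 h2
    have := hu0 i
    have := hu0 (i + 1)
    have := hv0 i
    have := hv0 (i + 1)
    rw [hHdef, hHdef]
    field_simp
    linear_combination v (i + 1) * h1 - u (i + 1) * h2
  have hHim : ∀ i, (H i).im =
      kp i * (u (i + 1) / u i).im - km (i + 1) * (v (i + 1) / v i).im := by
    intro i
    rw [hHdef, Complex.sub_im, Complex.im_ofReal_mul, Complex.im_ofReal_mul]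
  have hdir : (∀ i, 0 < lam.im * (u (i + 1) / u i).im ∧ lam.im * (v (i + 1) / v i).im < 0) ∨
      ∀ i, lam.im * (u (i + 1) / u i).im < 0 ∧ 0 < lam.im * (v (i + 1) / v i).im := by
    rcases hudir with ⟨hpr, hu1⟩ | ⟨hpr, hu1⟩ <;> rcases hvdir' with ⟨hpr', hv1⟩ | ⟨hpr', hv1⟩
    · refine Or.inl fun i => ⟨hu1 i, ?_⟩
      obtain ⟨c, hc, hci⟩ := hflip i
      have h := hv1 (-(i + 1))
      rw [hci] at h
      exact neg_of_mul_neg_right (by linarith : c * (lam.im * (v (i + 1) / v i).im) < 0) hc.le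
    · exact absurd hpr' hpr.not_gt
    · exact absurd hpr' hpr.not_gt
    · refine Or.inr fun i => ⟨hu1 i, ?_⟩
      obtain ⟨c, hc, hci⟩ := hflip i
      have h := hv1 (-(i + 1))
      rw [hci] at h
      exact pos_of_mul_pos_right (by linarith : 0 < c * (lam.im * (v (i + 1) / v i).im)) hc.le
  have hdir' : (∀ i, 0 < (u (i + 1) / u i).im ∧ (v (i + 1) / v i).im < 0) ∨
      ∀ i, (u (i + 1) / u i).im < 0 ∧ 0 < (v (i + 1) / v i).im := by
    rcases lt_or_gt_of_ne hlam with hl | hl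
    · refine hdir.symm.imp (fun h i => ?_) (fun h i => ?_)
      · exact ⟨pos_of_mul_neg_right (h i).1 hl.le, neg_of_mul_pos_right (h i).2 hl.le⟩
      · exact ⟨neg_of_mul_pos_right (h i).1 hl.le, pos_of_mul_neg_right (h i).2 hl.le⟩
    · refine hdir.imp (fun h i => ?_) (fun h i => ?_)
      · exact ⟨pos_of_mul_pos_right (h i).1 hl.le, neg_of_mul_neg_right (h i).2 hl.le⟩
      · exact ⟨neg_of_mul_neg_right (h i).1 hl.le, pos_of_mul_pos_right (h i).2 hl.le⟩
  rcases hdir' with h | h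
  · refine windingNum_of_counterrotating hu0 (fun i => (h i).1) (fun i => (h i).2) (fun i => ?_) hrel
    rw [hHim]
    have := mul_pos (hkp i) (h i).1
    have := mul_nonneg (hkm (i + 1)) (neg_pos.2 (h i).2).le
    linarith
  · have hw := windingNum_of_counterrotating (H := fun i => -H i) hv0 (fun i => (h i).2)
      (fun i => (h i).1) (fun i => ?_) (fun i => by linear_combination -hrel i)
    · rw [← hw.1]
      exact ⟨rfl, hw.2⟩
    · rw [Complex.neg_im, hHim]
      have := mul_pos (hkp i) (neg_pos.2 (h i).1)
      have := mul_nonneg (hkm (i + 1)) (h i).2.le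
      linarith
end

section
/- Let n ≥ 1, k⁺ᵢ > 0 and k⁻ᵢ ≥ 0 for i ∈ ℤ/nℤ, u ∈ ℂⁿ with u ≠ 0, and λ ∈ ℂ nonreal, and suppose λuᵢ = k⁺ᵢ u_{i+1} + k⁻ᵢ u_{i−1} − (k⁺ᵢ + k⁻ᵢ)uᵢ for all i (indices mod n). Let F = Σᵢ ln(k⁺ᵢ/k⁻ᵢ) ∈ (−∞, ∞], with F = ∞ if some k⁻ᵢ = 0. Then: (A) uᵢ ≠ 0 for all i; (B) Im(u_{i+1}/uᵢ) ≠ 0 for all i; (C) F ≠ 0, and for all i the sign of Im(u_{i+1}/uᵢ) equals the sign of F·Im λ (with the convention sign(∞) = 1, i.e. if some k⁻ᵢ = 0 then sign Im(u_{i+1}/uᵢ) = sign Im λ). -/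
open Finset

theorem ZMod.forall_of_succ {n : ℕ} [NeZero n] {P : ZMod n → Prop} {a : ZMod n} (ha : P a)
    (hsucc : ∀ i, P i → P (i + 1)) (i : ZMod n) : P i := by
  have key : ∀ m : ℕ, P (a + m) := by
    intro m
    induction m with
    | zero => simpa using ha
    | succ m ih => simpa [add_assoc] using hsucc _ ih
  simpa using key (i - a).val

theorem Real.sign_eq_sign_of_mul_pos {x y : ℝ} (h : 0 < x * y) : Real.sign x = Real.sign y := by
  rcases pos_and_pos_or_neg_and_neg_of_mul_pos h with ⟨hx, hy⟩ | ⟨hx, hy⟩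
  · rw [Real.sign_of_pos hx, Real.sign_of_pos hy]
  · rw [Real.sign_of_neg hx, Real.sign_of_neg hy]

/-- If `a i * x (i - 1) < b i * x i` around a cycle, with `a` and `x` positive, then the
logarithms of the ratios `b i / a i` have positive sum. -/
theorem ZMod.sum_log_div_pos {n : ℕ} [NeZero n] {a b x : ZMod n → ℝ} (ha : ∀ i, 0 < a i)
    (hx : ∀ i, 0 < x i) (h : ∀ i, a i * x (i - 1) < b i * x i) :
    0 < ∑ i, Real.log (b i / a i) := by
  have hshift : ∑ i, Real.log (x (i - 1)) = ∑ i, Real.log (x i) :=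
    Equiv.sum_comp (Equiv.subRight (1 : ZMod n)) fun i => Real.log (x i)
  calc (0 : ℝ) = ∑ i, (Real.log (x (i - 1)) - Real.log (x i)) := by
        rw [Finset.sum_sub_distrib, hshift, sub_self]
    _ < ∑ i, Real.log (b i / a i) := by
        refine Finset.sum_lt_sum_of_nonempty Finset.univ_nonempty fun i _ => ?_
        rw [← Real.log_div (hx _).ne' (hx _).ne']
        refine Real.log_lt_log (div_pos (hx _) (hx _)) ?_
        rw [div_lt_div_iff₀ (hx _) (ha _)]
        linarith [h i, mul_comm (a i) (x (i - 1))]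

/-- A cyclic flux `x` with nonnegative sources `w`, not all zero, that vanishes next to every
sourceless vertex has a constant strict sign. -/
theorem ZMod.flux_pos_or_neg {n : ℕ} [NeZero n] {kp km x w : ZMod n → ℝ} (hkp : ∀ i, 0 < kp i)
    (hkm : ∀ i, 0 ≤ km i) (hw : ∀ i, 0 ≤ w i) {a : ZMod n} (ha : 0 < w a)
    (hx : ∀ i, kp i * x i = km i * x (i - 1) + w i)
    (hprev : ∀ i, w i = 0 → x (i - 1) = 0) :
    (∀ i, 0 < x i) ∨ ∀ i, x i < 0 := by
  by_cases hneg : ∀ i, x i < 0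
  · exact Or.inr hneg
  push Not at hneg
  obtain ⟨b, hb⟩ := hneg
  have hnonneg : ∀ i, 0 ≤ x i := by
    refine ZMod.forall_of_succ hb fun i hi => ?_
    have h := hx (i + 1)
    rw [add_sub_cancel_right] at h
    refine nonneg_of_mul_nonneg_right (b := x (i + 1)) ?_ (hkp (i + 1))
    rw [h]
    exact add_nonneg (mul_nonneg (hkm _) hi) (hw _)
  have hpos : ∀ i, 0 < w i → 0 < x i := fun i hi => by
    refine pos_of_mul_pos_right (a := kp i) ?_ (hkp i).le
    rw [hx i]
    exact add_pos_of_nonneg_of_pos (mul_nonneg (hkm _) (hnonneg _)) hi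
  left
  refine fun i => hpos i (ZMod.forall_of_succ (P := fun j => 0 < w j) ha (fun j hj => ?_) i)
  refine (hw _).lt_of_ne' fun h0 => (hpos j hj).ne' ?_
  simpa using hprev _ h0

theorem unicyclic_halfplane_lemma
    (n : ℕ) [NeZero n] (hn : 1 ≤ n)
    (kp km : ZMod n → ℝ) (hkp : ∀ i, 0 < kp i) (hkm : ∀ i, 0 ≤ km i)
    (u : ZMod n → ℂ) (hu : u ≠ 0)
    (lam : ℂ) (hlam : lam.im ≠ 0)
    (heig : ∀ i, lam * u i =
      (kp i : ℂ) * u (i + 1) + (km i : ℂ) * u (i - 1) - ((kp i : ℂ) + (km i : ℂ)) * u i) :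
    (∀ i, u i ≠ 0) ∧
    (∀ i, (u (i + 1) / u i).im ≠ 0) ∧
    ((∀ i, km i ≠ 0) →
      (∑ i : ZMod n, Real.log (kp i / km i)) ≠ 0 ∧
      ∀ i, Real.sign ((u (i + 1) / u i).im) =
        Real.sign ((∑ j : ZMod n, Real.log (kp j / km j)) * lam.im)) ∧
    ((∃ i, km i = 0) →
      ∀ i, Real.sign ((u (i + 1) / u i).im) = Real.sign lam.im) := by
  set x : ZMod n → ℝ := fun i =>
    lam.im * ((u i).re * (u (i + 1)).im - (u i).im * (u (i + 1)).re) with hxdef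
  set w : ZMod n → ℝ := fun i => lam.im ^ 2 * Complex.normSq (u i) with hwdef
  have hflux : ∀ i, kp i * x i = km i * x (i - 1) + w i := fun i => by
    have hre := congrArg Complex.re (heig i)
    have him := congrArg Complex.im (heig i)
    simp only [Complex.mul_re, Complex.mul_im, Complex.add_re, Complex.add_im, Complex.sub_re,
      Complex.sub_im, Complex.ofReal_re, Complex.ofReal_im] at hre him
    simp only [hxdef, hwdef, Complex.normSq_apply, sub_add_cancel]
    linear_combination lam.im * (u i).im * hre - lam.im * (u i).re * him
  have hw : ∀ i, 0 ≤ w i := fun i => mul_nonneg (sq_nonneg _) (Complex.normSq_nonneg _)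
  have hw_pos : ∀ i, u i ≠ 0 → 0 < w i := fun i hi =>
    mul_pos (by positivity) (Complex.normSq_pos.2 hi)
  obtain ⟨a, ha⟩ := Function.ne_iff.1 hu
  have hprev : ∀ i, w i = 0 → x (i - 1) = 0 := fun i hi => by
    have h0 : u i = 0 := by_contra fun h => (hw_pos i h).ne' hi
    simp [hxdef, h0]
  have hsign := ZMod.flux_pos_or_neg hkp hkm hw (hw_pos a ha) hflux hprev
  have hx0 : ∀ i, x i ≠ 0 := fun i => hsign.elim (fun h => (h i).ne') fun h => (h i).ne
  have hu0 : ∀ i, u i ≠ 0 := fun i h => hx0 i (by simp [hxdef, h])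
  have hratio : ∀ i, x i = (u (i + 1) / u i).im * lam.im * Complex.normSq (u i) := fun i => by
    have := (Complex.normSq_pos.2 (hu0 i)).ne'
    rw [Complex.div_im]
    field_simp
    simp only [hxdef]
    ring
  have hnormSq : ∀ i, 0 < Complex.normSq (u i) := fun i => Complex.normSq_pos.2 (hu0 i)
  refine ⟨hu0, fun i h => hx0 i (by rw [hratio, h]; ring), fun hkm0 => ?_, ?_⟩
  · have hkm_pos : ∀ i, 0 < km i := fun i => (hkm i).lt_of_ne' (hkm0 i)
    suffices hF : ∀ i, 0 < x i * ∑ j, Real.log (kp j / km j) by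
      refine ⟨fun h => by simpa [h] using hF a, fun i => Real.sign_eq_sign_of_mul_pos ?_⟩
      have h := hF i
      rw [hratio i] at h
      refine pos_of_mul_pos_right (a := Complex.normSq (u i)) ?_ (hnormSq i).le
      linarith
    rcases hsign with hpos | hneg
    · refine fun i => mul_pos (hpos i) (ZMod.sum_log_div_pos hkm_pos hpos fun j => ?_)
      linarith [hflux j, hw_pos j (hu0 j)]
    · intro i
      -- Reverse the orientation of the cycle.
      have h := ZMod.sum_log_div_pos (a := fun j => kp (-j)) (b := fun j => km (-j))
        (x := fun j => -x (-j - 1)) (fun j => hkp _)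
        (fun j => neg_pos.2 (hneg _)) fun j => by
          have e : -(j - 1) - 1 = -j := by ring
          simp only [e]
          linarith [hflux (-j), hw_pos (-j) (hu0 _)]
      replace h := h.trans_eq
        (Equiv.sum_comp (Equiv.neg (ZMod n)) fun j => Real.log (km j / kp j))
      refine mul_pos_of_neg_of_neg (hneg i) ?_
      rw [← neg_pos, ← Finset.sum_neg_distrib]
      simpa only [← Real.log_inv, inv_div] using h
  · rintro ⟨b, hb⟩ i
    have hpos : ∀ j, 0 < x j := hsign.resolve_right fun hneg => by
      have h := hflux b
      rw [hb, zero_mul, zero_add] at h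
      linarith [hw_pos b (hu0 b), mul_neg_of_pos_of_neg (hkp b) (hneg b)]
    have h := hpos i
    rw [hratio i] at h
    exact Real.sign_eq_sign_of_mul_pos (pos_of_mul_pos_left h (hnormSq i).le)
end
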